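/- arXiv:1608.06555 — 4 statements merged into one kernel-verified Lean document; each statement's English description precedes it below -/
import Mathlib

section
/- The function φ(θ) := G(1/θ) − θ is strictly increasing on (0,∞), with lim_{θ→0+} φ(θ) = 1 and lim_{θ→+∞} φ(θ) = +∞. Consequently, for every real number r > 1 the equation G(1/θ) − θ = r has exactly one solution θ in (0,∞). -/
open MeasureTheory Filter

noncomputable def besselK (n : ℕ) (ζ : ℝ) : ℝ :=
  ∫ t in Set.Ioi (0 : ℝ), Real.cosh ((n : ℝ) * t) * Real.exp (-ζ * Real.cosh t)

noncomputable def Gfun (ζ : ℝ) : ℝ := besselK 2 ζ / besselK 1 ζ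

noncomputable def besselMoment (k : ℕ) (ζ : ℝ) : ℝ :=
  ∫ t in Set.Ioi (0 : ℝ), Real.cosh t ^ k * Real.exp (-ζ * Real.cosh t)

theorem cosh_pow_mul_exp_le (k : ℕ) {ζ : ℝ} (hζ : 0 < ζ) (t : ℝ) :
    Real.cosh t ^ k * Real.exp (-ζ * Real.cosh t) ≤
      2 * ((k + 1).factorial / ζ ^ (k + 1)) * Real.exp (-t) := by
  have hc := Real.cosh_pos t
  have h := Real.pow_div_factorial_le_exp (ζ * Real.cosh t) (by positivity) (k + 1)
  have hfac : (0 : ℝ) < (k + 1).factorial := by positivity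
  have h1 : Real.exp t ≤ 2 * Real.cosh t := by
    rw [Real.cosh_eq]; linarith [Real.exp_pos (-t)]
  rw [div_le_iff₀ hfac, mul_pow] at h
  rw [neg_mul, Real.exp_neg, Real.exp_neg, ← div_eq_mul_inv, ← div_eq_mul_inv, ← mul_div_assoc,
    div_div, div_le_div_iff₀ (Real.exp_pos _) (by positivity)]
  calc Real.cosh t ^ k * (ζ ^ (k + 1) * Real.exp t)
      ≤ Real.cosh t ^ k * (ζ ^ (k + 1) * (2 * Real.cosh t)) := by gcongr
    _ = 2 * (ζ ^ (k + 1) * Real.cosh t ^ (k + 1)) := by ring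
    _ ≤ 2 * (Real.exp (ζ * Real.cosh t) * (k + 1).factorial) := by gcongr
    _ = _ := by ring

theorem integrableOn_cosh_pow_mul_exp (k : ℕ) {ζ : ℝ} (hζ : 0 < ζ) :
    IntegrableOn (fun t => Real.cosh t ^ k * Real.exp (-ζ * Real.cosh t)) (Set.Ioi 0) := by
  refine Integrable.mono' ((integrableOn_exp_neg_Ioi 0).const_mul
    (2 * ((k + 1).factorial / ζ ^ (k + 1)))) ?_ (ae_of_all _ fun t => ?_)
  · exact (by fun_prop : Continuous fun t =>
      Real.cosh t ^ k * Real.exp (-ζ * Real.cosh t)).aestronglyMeasurable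
  · have := Real.cosh_pos t
    rw [Real.norm_of_nonneg (by positivity)]
    exact cosh_pow_mul_exp_le k hζ t

theorem continuousOn_besselMoment (k : ℕ) : ContinuousOn (besselMoment k) (Set.Ioi 0) := by
  intro ζ hζ
  rw [Set.mem_Ioi] at hζ
  refine ContinuousAt.continuousWithinAt ?_
  refine continuousAt_of_dominated (bound := fun t =>
    Real.cosh t ^ k * Real.exp (-(ζ / 2) * Real.cosh t)) ?_ ?_
    (integrableOn_cosh_pow_mul_exp k (half_pos hζ)) (ae_of_all _ fun t => by fun_prop)
  · exact Eventually.of_forall fun x => (by fun_prop : Continuous fun t =>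
      Real.cosh t ^ k * Real.exp (-x * Real.cosh t)).aestronglyMeasurable
  · filter_upwards [lt_mem_nhds (half_lt_self hζ)] with x hx
    refine ae_of_all _ fun t => ?_
    have := Real.cosh_pos t
    rw [Real.norm_of_nonneg (by positivity)]
    gcongr

theorem besselMoment_pos (k : ℕ) {ζ : ℝ} (hζ : 0 < ζ) : 0 < besselMoment k ζ := by
  have hpos : ∀ t, 0 < Real.cosh t ^ k * Real.exp (-ζ * Real.cosh t) := fun t => by
    have := Real.cosh_pos t
    positivity
  refine (integral_pos_iff_support_of_nonneg (fun t => (hpos t).le)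
    (integrableOn_cosh_pow_mul_exp k hζ)).2 ?_
  rw [Function.support_eq_univ fun t => (hpos t).ne']
  simp

theorem besselMoment_le_succ (k : ℕ) {ζ : ℝ} (hζ : 0 < ζ) :
    besselMoment k ζ ≤ besselMoment (k + 1) ζ := by
  refine integral_mono (integrableOn_cosh_pow_mul_exp k hζ)
    (integrableOn_cosh_pow_mul_exp (k + 1) hζ) fun t => ?_
  have := Real.one_le_cosh t
  dsimp only
  gcongr
  omega

theorem besselMoment_two {ζ : ℝ} (hζ : 0 < ζ) :
    besselMoment 2 ζ = besselMoment 0 ζ + besselMoment 1 ζ / ζ := by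
  have i0 := integrableOn_cosh_pow_mul_exp 0 hζ
  have i1 := integrableOn_cosh_pow_mul_exp 1 hζ
  have i2 := integrableOn_cosh_pow_mul_exp 2 hζ
  have hderiv : ∀ t ∈ Set.Ici (0 : ℝ),
      HasDerivAt (fun t => Real.sinh t * Real.exp (-ζ * Real.cosh t))
        (Real.cosh t ^ 1 * Real.exp (-ζ * Real.cosh t)
          - ζ * (Real.cosh t ^ 2 * Real.exp (-ζ * Real.cosh t)
            - Real.cosh t ^ 0 * Real.exp (-ζ * Real.cosh t))) t := by
    intro t _
    refine ((Real.hasDerivAt_sinh t).mul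
      (((Real.hasDerivAt_cosh t).const_mul (-ζ)).exp)).congr_deriv ?_
    rw [Real.cosh_sq t]
    ring
  have hbound : Tendsto (fun t : ℝ => 2 * ((1 + 1).factorial / ζ ^ (1 + 1)) * Real.exp (-t))
      atTop (nhds 0) := by
    simpa only [mul_zero] using Real.tendsto_exp_neg_atTop_nhds_zero.const_mul
      (2 * ((1 + 1).factorial / ζ ^ (1 + 1)) : ℝ)
  have hlim : Tendsto (fun t => Real.sinh t * Real.exp (-ζ * Real.cosh t)) atTop (nhds 0) := by
    refine squeeze_zero_norm (fun t => ?_) hbound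
    refine le_trans ?_ (cosh_pow_mul_exp_le 1 hζ t)
    rw [norm_mul, Real.norm_of_nonneg (Real.exp_pos _).le, pow_one]
    gcongr
    rw [Real.norm_eq_abs, abs_le]
    constructor <;> rw [Real.sinh_eq, Real.cosh_eq] <;>
      linarith [Real.exp_pos t, Real.exp_pos (-t)]
  have key := integral_Ioi_of_hasDerivAt_of_tendsto' hderiv
    (i1.sub ((i2.sub i0).const_mul ζ)) hlim
  have hsplit := integral_sub i1 ((i2.sub i0).const_mul ζ)
  simp only [Pi.sub_apply] at hsplit
  rw [hsplit, integral_const_mul, integral_sub i2 i0] at key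
  simp only [Real.sinh_zero, zero_mul, sub_zero] at key
  change besselMoment 1 ζ - ζ * (besselMoment 2 ζ - besselMoment 0 ζ) = 0 at key
  field_simp
  linarith

theorem besselK_one (ζ : ℝ) : besselK 1 ζ = besselMoment 1 ζ := by
  simp [besselK, besselMoment]

theorem besselK_two {ζ : ℝ} (hζ : 0 < ζ) :
    besselK 2 ζ = 2 * besselMoment 2 ζ - besselMoment 0 ζ := by
  rw [besselMoment, besselMoment, ← integral_const_mul,
    ← integral_sub ((integrableOn_cosh_pow_mul_exp 2 hζ).const_mul 2)
      (integrableOn_cosh_pow_mul_exp 0 hζ), besselK]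
  congr 1 with t
  push_cast
  rw [Real.cosh_two_mul, Real.sinh_sq]
  ring

theorem Gfun_one_div_sub {θ : ℝ} (hθ : 0 < θ) :
    Gfun (1 / θ) - θ = besselMoment 2 (1 / θ) / besselMoment 1 (1 / θ) := by
  have hζ : 0 < 1 / θ := by positivity
  have h1 := (besselMoment_pos 1 hζ).ne'
  have h2 := besselMoment_two hζ
  rw [div_div_eq_mul_div, div_one] at h2
  rw [Gfun, besselK_one, besselK_two hζ]
  field_simp
  linarith

theorem besselMoment_ratio_strictAntiOn :
    StrictAntiOn (fun ζ => besselMoment 2 ζ / besselMoment 1 ζ) (Set.Ioi 0) := by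
  intro ζ hζ η hη hlt
  rw [Set.mem_Ioi] at hζ hη
  dsimp only
  set m := besselMoment 2 η / besselMoment 1 η with hm
  have hm' : besselMoment 2 η - m * besselMoment 1 η = 0 := by
    rw [hm, div_mul_cancel₀ _ (besselMoment_pos 1 hη).ne', sub_self]
  rw [lt_div_iff₀ (besselMoment_pos 1 hζ), ← sub_pos]
  set A := Real.exp ((η - ζ) * m)
  have h_integrable (x : ℝ) (hx : 0 < x) := (integrableOn_cosh_pow_mul_exp 2 hx).sub
    ((integrableOn_cosh_pow_mul_exp 1 hx).const_mul m)
  have hval (x : ℝ) (hx : 0 < x) : ∫ t in Set.Ioi (0 : ℝ),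
      (Real.cosh t ^ 2 * Real.exp (-x * Real.cosh t)
        - m * (Real.cosh t ^ 1 * Real.exp (-x * Real.cosh t)))
      = besselMoment 2 x - m * besselMoment 1 x := by
    rw [integral_sub (integrableOn_cosh_pow_mul_exp 2 hx)
      ((integrableOn_cosh_pow_mul_exp 1 hx).const_mul m), integral_const_mul]
    rfl
  have hdiff := integral_sub (h_integrable ζ hζ) ((h_integrable η hη).const_mul A)
  simp only [Pi.sub_apply] at hdiff
  rw [integral_const_mul, hval ζ hζ, hval η hη, hm', mul_zero, sub_zero] at hdiff
  rw [← hdiff]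
  have hfac (t : ℝ) : Real.cosh t ^ 2 * Real.exp (-ζ * Real.cosh t)
        - m * (Real.cosh t ^ 1 * Real.exp (-ζ * Real.cosh t))
        - A * (Real.cosh t ^ 2 * Real.exp (-η * Real.cosh t)
        - m * (Real.cosh t ^ 1 * Real.exp (-η * Real.cosh t)))
      = Real.cosh t * Real.exp (-η * Real.cosh t) *
        ((Real.cosh t - m) * (Real.exp ((η - ζ) * Real.cosh t) - A)) := by
    have : Real.exp (-ζ * Real.cosh t)
        = Real.exp (-η * Real.cosh t) * Real.exp ((η - ζ) * Real.cosh t) := by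
      rw [← Real.exp_add]; ring_nf
    rw [this]; ring
  have hpos (t : ℝ) (ht : Real.cosh t ≠ m) :
      0 < Real.cosh t * Real.exp (-η * Real.cosh t) *
        ((Real.cosh t - m) * (Real.exp ((η - ζ) * Real.cosh t) - A)) := by
    refine mul_pos (mul_pos (Real.cosh_pos t) (Real.exp_pos _)) ?_
    rcases lt_or_gt_of_ne ht with h | h
    · refine mul_pos_of_neg_of_neg (sub_neg.2 h) (sub_neg.2 (Real.exp_lt_exp.2 ?_))
      exact mul_lt_mul_of_pos_left h (sub_pos.2 hlt)
    · refine mul_pos (sub_pos.2 h) (sub_pos.2 (Real.exp_lt_exp.2 ?_))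
      exact mul_lt_mul_of_pos_left h (sub_pos.2 hlt)
  have hsub := (h_integrable ζ hζ).sub ((h_integrable η hη).const_mul A)
  refine (integral_pos_iff_support_of_nonneg (fun t => ?_) hsub).2 ?_
  · simp only [Pi.zero_apply, Pi.sub_apply]
    rw [hfac]
    by_cases h : Real.cosh t = m
    · simp [h]
    · exact (hpos t h).le
  · refine lt_of_lt_of_le ?_ (measure_mono (s := Set.Ioi (max 0 m)) fun t ht => ?_)
    · rw [Measure.restrict_apply measurableSet_Ioi, Set.Ioi_inter_Ioi]
      simp
    · rw [Function.mem_support]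
      simp only [Pi.sub_apply]
      rw [hfac]
      refine (hpos t ?_).ne'
      rw [Set.mem_Ioi, max_lt_iff] at ht
      have h1 := (Real.self_lt_sinh_iff.2 ht.1).trans (Real.sinh_lt_cosh t)
      exact (ht.2.trans h1).ne'

theorem stmt1 :
    StrictMonoOn (fun θ : ℝ => Gfun (1 / θ) - θ) (Set.Ioi 0) ∧
    Tendsto (fun θ : ℝ => Gfun (1 / θ) - θ) (nhdsWithin 0 (Set.Ioi 0)) (nhds 1) ∧
    Tendsto (fun θ : ℝ => Gfun (1 / θ) - θ) atTop atTop ∧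
    ∀ r : ℝ, 1 < r → ∃! θ : ℝ, θ ∈ Set.Ioi (0 : ℝ) ∧ Gfun (1 / θ) - θ = r := by
  have hmono : StrictMonoOn (fun θ : ℝ => Gfun (1 / θ) - θ) (Set.Ioi 0) := by
    intro a ha b hb hab
    dsimp only
    rw [Gfun_one_div_sub ha, Gfun_one_div_sub hb]
    exact besselMoment_ratio_strictAntiOn (Set.mem_Ioi.2 (one_div_pos.2 hb))
      (Set.mem_Ioi.2 (one_div_pos.2 ha))
      (one_div_lt_one_div_of_lt ha hab)
  have hle (θ : ℝ) (hθ : 0 < θ) : 1 ≤ Gfun (1 / θ) - θ ∧ Gfun (1 / θ) - θ ≤ 1 + θ ∧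
      θ ≤ Gfun (1 / θ) - θ := by
    have hζ : 0 < 1 / θ := one_div_pos.2 hθ
    have h0 := besselMoment_pos 0 hζ
    have h1 := besselMoment_pos 1 hζ
    have h01 : _ ≤ besselMoment 1 _ := besselMoment_le_succ 0 hζ
    have h12 : _ ≤ besselMoment 2 _ := besselMoment_le_succ 1 hζ
    have h2 := besselMoment_two hζ
    rw [div_div_eq_mul_div, div_one] at h2
    rw [Gfun_one_div_sub hθ, le_div_iff₀ h1, div_le_iff₀ h1, le_div_iff₀ h1]
    refine ⟨?_, ?_, ?_⟩ <;> linarith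
  have hzero : Tendsto (fun θ : ℝ => Gfun (1 / θ) - θ)
      (nhdsWithin 0 (Set.Ioi 0)) (nhds 1) := by
    have hupper : Tendsto (fun θ : ℝ => 1 + θ) (nhdsWithin 0 (Set.Ioi 0)) (nhds 1) := by
      have : Tendsto (fun θ : ℝ => 1 + θ) (nhds 0) (nhds (1 + 0)) :=
        tendsto_const_nhds.add tendsto_id
      rw [add_zero] at this
      exact this.mono_left nhdsWithin_le_nhds
    refine tendsto_of_tendsto_of_tendsto_of_le_of_le' tendsto_const_nhds hupper ?_ ?_
    · filter_upwards [self_mem_nhdsWithin] with θ hθ using (hle θ hθ).1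
    · filter_upwards [self_mem_nhdsWithin] with θ hθ using (hle θ hθ).2.1
  have htop : Tendsto (fun θ : ℝ => Gfun (1 / θ) - θ) atTop atTop := by
    refine tendsto_atTop_mono' atTop ?_ tendsto_id
    filter_upwards [eventually_gt_atTop 0] with θ hθ using (hle θ hθ).2.2
  refine ⟨hmono, hzero, htop, fun r hr => ?_⟩
  have hcont : ContinuousOn (fun θ : ℝ => Gfun (1 / θ) - θ) (Set.Ioi 0) := by
    have hinv : ContinuousOn (fun θ : ℝ => 1 / θ) (Set.Ioi 0) :=
      continuousOn_const.div continuousOn_id fun θ hθ => (Set.mem_Ioi.1 hθ).ne'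
    have hmaps : Set.MapsTo (fun θ : ℝ => 1 / θ) (Set.Ioi 0) (Set.Ioi 0) :=
      fun θ hθ => Set.mem_Ioi.2 (one_div_pos.2 hθ)
    refine ContinuousOn.congr (((continuousOn_besselMoment 2).comp hinv hmaps).div
      ((continuousOn_besselMoment 1).comp hinv hmaps) fun θ hθ => ?_)
      fun θ hθ => Gfun_one_div_sub hθ
    exact (besselMoment_pos 1 (hmaps hθ)).ne'
  have ha : 0 < (r - 1) / 2 := by linarith
  have hab : (r - 1) / 2 ≤ r := by linarith
  obtain ⟨θ, hθ, hθr⟩ := intermediate_value_Icc hab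
    (hcont.mono fun x hx => ha.trans_le hx.1)
    ⟨by linarith [(hle _ ha).2.1], (hle r (by linarith)).2.2⟩
  refine ⟨θ, ⟨ha.trans_le hθ.1, hθr⟩, fun y hy => ?_⟩
  exact hmono.injOn hy.1 (ha.trans_le hθ.1) (hy.2.trans hθr.symm)
end

section
/- For every n ≥ 1, the n zeros of P_n^(1)(·;ζ) and the n+1 zeros of P_{n+1}^(0)(·;ζ) strictly interlace: 1 < x_{1,n+1}^(0) < x_{1,n}^(1) < x_{2,n+1}^(0) < x_{2,n}^(1) < ⋯ < x_{n,n}^(1) < x_{n+1,n+1}^(0). -/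
open MeasureTheory Polynomial

noncomputable def wgt (ℓ : ℕ) (ζ x : ℝ) : ℝ :=
  (x ^ 2 - 1) ^ ((ℓ : ℝ) - 1 / 2) * Real.exp (-ζ * x) / besselK 1 ζ

/-- A submodule containing polynomials of every degree below `N` contains all polynomials of
degree below `N`. -/
theorem mem_of_degree_lt {P : ℕ → ℝ[X]} (hdeg : ∀ n, (P n).natDegree = n) (hne : ∀ n, P n ≠ 0)
    (M : Submodule ℝ ℝ[X]) : ∀ N : ℕ, (∀ k < N, P k ∈ M) → ∀ p : ℝ[X], p.degree < N → p ∈ M := by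
  intro N
  induction N with
  | zero =>
    intro _ p hp
    have : p = 0 := by
      rw [← degree_eq_bot]
      simpa using hp
    rw [this]
    exact M.zero_mem
  | succ N ih =>
    intro hM p hp
    have hlc : (P N).coeff N ≠ 0 := by
      have := leadingCoeff_ne_zero.mpr (hne N)
      rwa [leadingCoeff, hdeg] at this
    have hp' : p.degree ≤ N := by
      rw [degree_le_iff_coeff_zero]
      rw [degree_lt_iff_coeff_zero] at hp
      intro m hm
      exact hp m (by exact_mod_cast hm)
    have hr : (p - (p.coeff N / (P N).coeff N) • P N).degree < N := by
      rw [degree_lt_iff_coeff_zero]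
      intro m hm
      rcases hm.eq_or_lt with rfl | hm
      · simp [hlc]
      · have h1 : p.coeff m = 0 := coeff_eq_zero_of_degree_lt (hp'.trans_lt (by exact_mod_cast hm))
        have h2 : (P N).coeff m = 0 := coeff_eq_zero_of_natDegree_lt (by rw [hdeg]; exact hm)
        simp [h1, h2]
    have h1 := ih (fun k hk => hM k (by omega)) _ hr
    have h2 := M.add_mem h1 (M.smul_mem (p.coeff N / (P N).coeff N) (hM N (by omega)))
    simpa using h2

theorem map_mul_eq_zero_of_degree_lt {P : ℕ → ℝ[X]} (hdeg : ∀ n, (P n).natDegree = n)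
    (hne : ∀ n, P n ≠ 0) (L : ℝ[X] →ₗ[ℝ] ℝ) (horth : ∀ m n, m ≠ n → L (P m * P n) = 0)
    (n : ℕ) (q : ℝ[X]) (hq : q.degree < n) : L (q * P n) = 0 :=
  mem_of_degree_lt hdeg hne (LinearMap.ker (L.comp (LinearMap.mulRight ℝ (P n)))) n
    (fun k hk => by simpa using horth k n hk.ne) q hq

/-- A functional with an orthonormal sequence of polynomials is positive definite. -/
theorem map_mul_self_pos {P : ℕ → ℝ[X]} (hdeg : ∀ n, (P n).natDegree = n) (hne : ∀ n, P n ≠ 0)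
    (L : ℝ[X] →ₗ[ℝ] ℝ) (horth : ∀ m n, L (P m * P n) = if m = n then 1 else 0)
    (p : ℝ[X]) (hp : p ≠ 0) : 0 < L (p * p) := by
  induction hn : p.natDegree using Nat.strong_induction_on generalizing p with
  | _ n ih =>
    subst hn
    set n := p.natDegree with hn
    have hlc := leadingCoeff_ne_zero.mpr (hne n)
    set c := p.leadingCoeff / (P n).leadingCoeff with hc
    have hc0 : c ≠ 0 := div_ne_zero (leadingCoeff_ne_zero.mpr hp) hlc
    set r := p - C c * P n with hr
    have hrd : r.degree < p.degree := by
      apply degree_sub_lt_left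
      · rw [degree_C_mul hc0, degree_eq_natDegree hp, degree_eq_natDegree (hne n), hdeg]
      · exact hp
      · rw [leadingCoeff_mul, leadingCoeff_C, hc]
        field_simp
    have hr0 : 0 ≤ L (r * r) := by
      by_cases h : r = 0
      · simp [h]
      · exact (ih r.natDegree (natDegree_lt_natDegree h hrd) r h rfl).le
    have hrP : L (r * P n) = 0 := by
      apply map_mul_eq_zero_of_degree_lt hdeg hne L (fun m n h => by simp [horth, h])
      rwa [degree_eq_natDegree hp] at hrd
    have e : p * p = c ^ 2 • (P n * P n) + (2 * c) • (r * P n) + r * r := by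
      have : p = r + C c * P n := by rw [hr]; ring
      rw [this]
      simp only [smul_eq_C_mul, map_pow, map_mul, map_ofNat]
      ring
    rw [e, map_add, map_add, map_smul, map_smul, hrP, horth]
    simp only [if_true, smul_eq_mul]
    nlinarith [pow_pos (abs_pos.mpr hc0) 2, sq_abs c]

/-- If `p = (X - a) * l` is orthogonal to all polynomials of degree below `deg p`, then
`L (l * s) = s(a) * L l` for `deg s ≤ deg l`. -/
theorem map_mul_eq_eval_mul (L : ℝ[X] →ₗ[ℝ] ℝ) {n : ℕ} {p l : ℝ[X]} {a : ℝ}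
    (hp : p = (X - C a) * l) (horth : ∀ q : ℝ[X], q.degree < (n + 1 : ℕ) → L (q * p) = 0)
    {s : ℝ[X]} (hs : s.degree < (n + 1 : ℕ)) : L (l * s) = s.eval a * L l := by
  have hd := mul_divByMonic_eq_iff_isRoot (p := s - C (s.eval a)) (a := a) |>.mpr (by simp)
  set q := (s - C (s.eval a)) /ₘ (X - C a) with hq
  have hqd : q.degree < (n + 1 : ℕ) := by
    refine (degree_divByMonic_le _ _).trans_lt ((degree_sub_le _ _).trans_lt (max_lt hs ?_))
    exact degree_C_le.trans_lt (by exact_mod_cast Nat.succ_pos n)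
  have e : l * s = q * p + s.eval a • l := by
    have : s = (X - C a) * q + C (s.eval a) := by rw [hd]; ring
    rw [hp, smul_eq_C_mul]
    nth_rewrite 1 [this]
    ring
  rw [e, map_add, horth q hqd, map_smul, smul_eq_mul, zero_add]

theorem prod_erase_mul_prod_erase_neg {N : ℕ} {z : ℕ → ℝ}
    (hz : ∀ i j, 1 ≤ i → i < j → j ≤ N → z i < z j) {i : ℕ} (hi : 1 ≤ i) (hiN : i + 1 ≤ N) :
    (∏ j ∈ (Finset.Icc 1 N).erase i, (z i - z j)) *
      (∏ j ∈ (Finset.Icc 1 N).erase (i + 1), (z (i + 1) - z j)) < 0 := by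
  have h1 : i + 1 ∈ (Finset.Icc 1 N).erase i := by simp; omega
  have h2 : i ∈ (Finset.Icc 1 N).erase (i + 1) := by simp; omega
  rw [← Finset.mul_prod_erase _ _ h1, ← Finset.mul_prod_erase _ _ h2,
    Finset.erase_right_comm (a := i + 1)]
  have hlt := hz i (i + 1) hi (by omega) hiN
  have hpos : 0 < ∏ j ∈ ((Finset.Icc 1 N).erase i).erase (i + 1),
      (z i - z j) * (z (i + 1) - z j) := by
    apply Finset.prod_pos
    intro j hj
    simp only [Finset.mem_erase, Finset.mem_Icc] at hj
    rcases lt_or_gt_of_ne hj.2.1 with h | h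
    · have := hz j i hj.2.2.1 h (by omega)
      exact mul_pos (by linarith) (by linarith)
    · have := hz (i + 1) j (by omega) (by omega) hj.2.2.2
      exact mul_pos_of_neg_of_neg (by linarith) (by linarith)
  rw [Finset.prod_mul_distrib] at hpos
  nlinarith [mul_pos (pow_pos (sub_pos.mpr hlt) 2) hpos]

/-- If each of the `n` gaps `(z i, z (i + 1))` contains a member of the increasing family
`y 1 < ⋯ < y n`, then `y i` lies in the `i`-th gap. -/
theorem interlace_of_mem_gaps {n : ℕ} {y z : ℕ → ℝ}
    (hy : ∀ i j, 1 ≤ i → i < j → j ≤ n → y i < y j)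
    (h : ∀ i, 1 ≤ i → i ≤ n → ∃ j, 1 ≤ j ∧ j ≤ n ∧ z i < y j ∧ y j < z (i + 1)) :
    ∀ i, 1 ≤ i → i ≤ n → z i < y i ∧ y i < z (i + 1) := by
  choose! f hf1 hfn hfl hfu using h
  have hmono : ∀ i, 1 ≤ i → i + 1 ≤ n → f i < f (i + 1) := by
    intro i hi hin
    by_contra! hle
    have h1 := hfu i hi (by omega)
    have h2 := hfl (i + 1) (by omega) hin
    have h3 : y (f (i + 1)) ≤ y (f i) := by
      rcases hle.eq_or_lt with e | e
      · rw [e]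
      · exact (hy _ _ (hf1 _ (by omega) hin) e (hfn i hi (by omega))).le
    linarith
  have hge : ∀ i, 1 ≤ i → i ≤ n → i ≤ f i := by
    intro i hi
    induction i, hi using Nat.le_induction with
    | base => exact fun hn => hf1 1 le_rfl hn
    | succ i hi ih =>
      intro hin
      have := ih (by omega)
      have := hmono i hi hin
      omega
  have hle : ∀ k, ∀ i, 1 ≤ i → i + k = n → f i ≤ i := by
    intro k
    induction k with
    | zero =>
      intro i hi hin
      have := hfn i hi (by omega)
      omega
    | succ k ih =>
      intro i hi hin
      have := ih (i + 1) (by omega) (by omega)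
      have := hmono i hi (by omega)
      omega
  intro i hi hin
  have e : f i = i := le_antisymm (hle (n - i) i hi (by omega)) (hge i hi hin)
  have h1 := hfl i hi hin
  have h2 := hfu i hi hin
  rw [e] at h1 h2
  exact ⟨h1, h2⟩

theorem eval_C_mul_prod (c : ℝ) (s : Finset ℕ) (z : ℕ → ℝ) (x : ℝ) :
    (C c * ∏ j ∈ s, (X - C (z j))).eval x = c * ∏ j ∈ s, (x - z j) := by
  simp [eval_prod]

theorem wgt_nonneg (ℓ : ℕ) (ζ : ℝ) {x : ℝ} (hx : 1 < x) : 0 ≤ wgt ℓ ζ x := by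
  have hK : 0 ≤ besselK 1 ζ :=
    integral_nonneg fun t => mul_nonneg (Real.cosh_pos _).le (Real.exp_pos _).le
  have h : 0 ≤ x ^ 2 - 1 := by nlinarith
  unfold wgt
  exact div_nonneg (mul_nonneg (Real.rpow_nonneg h _) (Real.exp_pos _).le) hK

theorem measurable_wgt (ℓ : ℕ) (ζ : ℝ) : Measurable (wgt ℓ ζ) := by
  unfold wgt
  fun_prop

theorem wgt_one_eq (ζ : ℝ) {x : ℝ} (hx : 1 < x) : wgt 1 ζ x = (x ^ 2 - 1) * wgt 0 ζ x := by
  have h : 0 < x ^ 2 - 1 := by nlinarith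
  unfold wgt
  have e : ((1 : ℕ) : ℝ) - 1 / 2 = 1 + (((0 : ℕ) : ℝ) - 1 / 2) := by norm_num
  rw [e, Real.rpow_add h, Real.rpow_one]
  ring

/-- A nonnegative weight for which some sequence of polynomials of all degrees has unit norms
has finite moments. -/
theorem integrable_eval_mul {P : ℕ → ℝ[X]} (hdeg : ∀ n, (P n).natDegree = n)
    (hne : ∀ n, P n ≠ 0) {μ : Measure ℝ} {w : ℝ → ℝ} (hw : Measurable w)
    (hw0 : ∀ᵐ x ∂μ, 0 ≤ w x) (hnorm : ∀ n, ∫ x, (P n).eval x * (P n).eval x * w x ∂μ = 1)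
    (p : ℝ[X]) : Integrable (fun x => p.eval x * w x) μ := by
  have hsq (n : ℕ) : Integrable (fun x => (P n).eval x * (P n).eval x * w x) μ := by
    by_contra h
    have := hnorm n
    rw [integral_undef h] at this
    exact zero_ne_one this
  obtain ⟨a, ha⟩ : ∃ a, P 0 = C a := ⟨_, eq_C_of_natDegree_eq_zero (hdeg 0)⟩
  have ha0 : a ≠ 0 := by
    rintro rfl
    exact hne 0 (by simpa using ha)
  have hP (n : ℕ) : Integrable (fun x => (P n).eval x * w x) μ := by
    have h1 : Integrable (fun x => (P 0).eval x * (P n).eval x * w x) μ := by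
      refine ((hsq 0).add (hsq n)).mono' ?_ ?_
      · exact (((P 0).continuous.mul (P n).continuous).measurable.mul hw).aestronglyMeasurable
      · filter_upwards [hw0] with x hx
        simp only [Pi.add_apply, norm_mul, Real.norm_eq_abs, abs_of_nonneg hx]
        rw [← add_mul]
        apply mul_le_mul_of_nonneg_right _ hx
        nlinarith [sq_nonneg (|(P 0).eval x| - |(P n).eval x|), sq_abs ((P 0).eval x),
          sq_abs ((P n).eval x), sq_nonneg ((P 0).eval x), sq_nonneg ((P n).eval x)]
    refine (h1.const_mul a⁻¹).congr (Filter.Eventually.of_forall fun x => ?_)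
    simp only [ha, eval_C]
    field_simp
  let M : Submodule ℝ ℝ[X] :=
    { carrier := {q | Integrable (fun x => q.eval x * w x) μ}
      add_mem' := fun {q r} hq hr => by
        simp only [Set.mem_ofPred_eq, eval_add, add_mul]
        exact Integrable.add hq hr
      zero_mem' := by simp
      smul_mem' := fun c q hq => by
        simpa only [Set.mem_ofPred_eq, eval_smul, smul_eq_mul, mul_assoc] using
          Integrable.const_mul hq c }
  exact mem_of_degree_lt hdeg hne M (p.natDegree + 1) (fun k _ => hP k) p
    (degree_le_natDegree.trans_lt (by exact_mod_cast Nat.lt_succ_self _))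

/-- Let `p` be orthogonal to lower degrees with respect to a positive definite functional `L`, with
simple zeros `z 1 < ⋯ < z (n + 1)` at which `w` is positive, and let `R` of degree `n` be
orthogonal to lower degrees with respect to `q ↦ L (w * q)`, where `deg w = 2`. Then `R` changes
sign between consecutive zeros of `p`. -/
theorem eval_mul_eval_neg_of_orthogonal (L : ℝ[X] →ₗ[ℝ] ℝ) (hpos : ∀ p, p ≠ 0 → 0 < L (p * p))
    {n : ℕ} {z : ℕ → ℝ} (hz : ∀ i j, 1 ≤ i → i < j → j ≤ n + 1 → z i < z j)
    {w R p : ℝ[X]} {c : ℝ} (hc : 0 < c)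
    (hp : p = C c * ∏ i ∈ Finset.Icc 1 (n + 1), (X - C (z i)))
    (hpd : p.natDegree = n + 1) (hwd : w.natDegree = 2) (hRd : R.natDegree = n) (hR0 : R ≠ 0)
    (hwz : ∀ i, 1 ≤ i → i ≤ n + 1 → 0 < w.eval (z i))
    (hpo : ∀ q : ℝ[X], q.degree < (n + 1 : ℕ) → L (q * p) = 0)
    (hRo : ∀ q : ℝ[X], q.degree < (n : ℕ) → L (w * (q * R)) = 0)
    {i : ℕ} (hi : 1 ≤ i) (hin : i ≤ n) : R.eval (z i) * R.eval (z (i + 1)) < 0 := by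
  have hp0 : p ≠ 0 := by
    rintro rfl
    simp at hpd
  set S := (w * R) % p with hS
  set l : ℕ → ℝ[X] := fun i => C c * ∏ j ∈ (Finset.Icc 1 (n + 1)).erase i, (X - C (z j)) with hl
  have hpl : ∀ i, 1 ≤ i → i ≤ n + 1 → p = (X - C (z i)) * l i := by
    intro i h1 h2
    rw [hp, hl, ← Finset.mul_prod_erase _ _ (Finset.mem_Icc.mpr ⟨h1, h2⟩)]
    ring
  have hdivmod : S = w * R - p * (w * R / p) := by
    rw [hS, eq_sub_iff_add_eq, add_comm]
    exact EuclideanDomain.div_add_mod _ _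
  have hSz : ∀ i, 1 ≤ i → i ≤ n + 1 → S.eval (z i) = w.eval (z i) * R.eval (z i) := by
    intro i h1 h2
    rw [hdivmod]
    nth_rewrite 1 [hpl i h1 h2]
    simp
  have hSd : S.degree < (n + 1 : ℕ) := by
    have := EuclideanDomain.mod_lt (w * R) hp0
    change S.degree < p.degree at this
    rwa [degree_eq_natDegree hp0, hpd] at this
  have hSo : ∀ q : ℝ[X], q.degree < (n : ℕ) → L (q * S) = 0 := by
    intro q hq
    have e : q * S = w * (q * R) - q * (w * R / p) * p := by rw [hdivmod]; ring
    rw [e, map_sub, hRo q hq, hpo, sub_zero]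
    by_cases hq0 : q = 0
    · simp [hq0]
    have hqn : q.natDegree < n := (natDegree_lt_iff_degree_lt hq0).mpr hq
    have hd : (w * R / p).natDegree ≤ 1 := by
      have hw0 : w ≠ 0 := by
        rintro rfl
        simp at hwd
      have hwR : (w * R).degree = (n + 2 : ℕ) := by
        rw [degree_eq_natDegree (mul_ne_zero hw0 hR0), natDegree_mul hw0 hR0, hwd, hRd, add_comm]
      have hpd' : p.degree = (n + 1 : ℕ) := by rw [degree_eq_natDegree hp0, hpd]
      have hle : p.degree ≤ (w * R).degree := by
        rw [hwR, hpd']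
        exact_mod_cast Nat.le_succ (n + 1)
      have hadd := degree_add_div hp0 hle
      by_cases hd0 : w * R / p = 0
      · simp [hd0]
      rw [hwR, hpd', degree_eq_natDegree hd0] at hadd
      have : n + 1 + (w * R / p).natDegree = n + 2 := by exact_mod_cast hadd
      omega
    refine (degree_le_natDegree).trans_lt ?_
    have := natDegree_mul_le (p := q) (q := w * R / p)
    exact_mod_cast (by omega : (q * (w * R / p)).natDegree < n + 1)
  have hS0 : S ≠ 0 := by
    intro h
    have hroot : ∀ i ∈ Finset.Icc 1 (n + 1), R.eval (z i) = 0 := by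
      intro i hi
      rw [Finset.mem_Icc] at hi
      have := hSz i hi.1 hi.2
      rw [h, eval_zero] at this
      exact (mul_eq_zero.mp this.symm).resolve_left (hwz i hi.1 hi.2).ne'
    have hinj : Set.InjOn z (Finset.Icc 1 (n + 1) : Finset ℕ) := by
      intro a ha b hb hab
      simp only [Finset.coe_Icc, Set.mem_Icc] at ha hb
      by_contra hne
      rcases lt_or_gt_of_ne hne with h | h
      · exact (hz a b ha.1 h hb.2).ne hab
      · exact (hz b a hb.1 h ha.2).ne' hab
    apply hR0
    apply eq_zero_of_degree_lt_of_eval_index_eq_zero _ hinj _ hroot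
    rw [degree_eq_natDegree hR0, hRd]
    simp
    exact_mod_cast Nat.lt_succ_self n
  have hSn : S.natDegree = n := by
    have h1 : S.natDegree < n + 1 := (natDegree_lt_iff_degree_lt hS0).mpr hSd
    by_contra h2
    have h3 : S.degree < n := (natDegree_lt_iff_degree_lt hS0).mp (by omega)
    exact (hpos S hS0).ne' (hSo S h3)
  have hkey : ∀ i, 1 ≤ i → i ≤ n + 1 →
      0 < S.leadingCoeff * (R.eval (z i) * (l i).eval (z i)) := by
    intro i h1 h2
    have hli0 : l i ≠ 0 := by
      intro h
      exact hp0 (by rw [hpl i h1 h2, h, mul_zero])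
    have hlid : (l i).natDegree = n := by
      have := hpd
      rw [hpl i h1 h2, natDegree_mul (X_sub_C_ne_zero _) hli0, natDegree_X_sub_C] at this
      omega
    have hlil : (l i).leadingCoeff = c := by
      simp only [hl, leadingCoeff_mul, leadingCoeff_C, leadingCoeff_prod, leadingCoeff_X_sub_C,
        Finset.prod_const_one, mul_one]
    have hlidlt : (l i).degree < (n + 1 : ℕ) := by
      rw [degree_eq_natDegree hli0, hlid]
      exact_mod_cast Nat.lt_succ_self n
    have hlc := leadingCoeff_ne_zero.mpr hS0
    have hA := map_mul_eq_eval_mul L (hpl i h1 h2) hpo hSd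
    have hB := map_mul_eq_eval_mul L (hpl i h1 h2) hpo hlidlt
    have hlpos := hpos _ hli0
    have hSpos := hpos _ hS0
    have hC : L (l i * S) = c / S.leadingCoeff * L (S * S) := by
      have hd : (l i - C (c / S.leadingCoeff) * S).degree < (l i).degree := by
        have hcs : c / S.leadingCoeff ≠ 0 := div_ne_zero hc.ne' hlc
        apply degree_sub_lt_left
        · rw [degree_C_mul hcs, degree_eq_natDegree hli0, degree_eq_natDegree hS0, hlid, hSn]
        · exact hli0
        · rw [hlil, leadingCoeff_mul, leadingCoeff_C]
          field_simp
      rw [degree_eq_natDegree hli0, hlid] at hd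
      have := hSo _ hd
      have e : (l i - C (c / S.leadingCoeff) * S) * S =
          l i * S - (c / S.leadingCoeff) • (S * S) := by
        rw [smul_eq_C_mul]; ring
      rw [e, map_sub, map_smul, smul_eq_mul] at this
      linarith
    rw [hSz i h1 h2] at hA
    have hw := hwz i h1 h2
    have hD : S.leadingCoeff * (R.eval (z i) * (l i).eval (z i)) *
        (w.eval (z i) * L (l i) ^ 2) = c * L (S * S) * L (l i * l i) := by
      have : c * L (S * S) = S.leadingCoeff * L (l i * S) := by rw [hC]; field_simp
      rw [this, hA, hB]
      ring
    have hE : 0 < c * L (S * S) * L (l i * l i) := by positivity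
    rw [← hD] at hE
    exact pos_of_mul_pos_left hE (by positivity)
  have k1 := hkey i hi (by omega)
  have k2 := hkey (i + 1) (by omega) (by omega)
  have hll : (l i).eval (z i) * (l (i + 1)).eval (z (i + 1)) < 0 := by
    simp only [hl, eval_C_mul_prod]
    have := prod_erase_mul_prod_erase_neg hz hi (by omega)
    nlinarith [mul_pos hc hc]
  have k3 := mul_pos k1 k2
  by_contra! hcon
  have : 0 ≤ S.leadingCoeff ^ 2 * (R.eval (z i) * R.eval (z (i + 1))) := by positivity
  nlinarith

theorem stmt11
    (ζ : ℝ) (hζ : 0 < ζ)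
    (P0 P1 : ℕ → Polynomial ℝ) (lc0 lc1 : ℕ → ℝ)
    (hdeg0 : ∀ n, (P0 n).natDegree = n)
    (hdeg1 : ∀ n, (P1 n).natDegree = n)
    (hlc0 : ∀ n, (P0 n).leadingCoeff = lc0 n)
    (hlc1 : ∀ n, (P1 n).leadingCoeff = lc1 n)
    (hlc0pos : ∀ n, 0 < lc0 n)
    (hlc1pos : ∀ n, 0 < lc1 n)
    (horth0 : ∀ m n, (∫ x in Set.Ioi (1 : ℝ),
        (P0 m).eval x * (P0 n).eval x * wgt 0 ζ x) = if m = n then (1 : ℝ) else 0)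
    (horth1 : ∀ m n, (∫ x in Set.Ioi (1 : ℝ),
        (P1 m).eval x * (P1 n).eval x * wgt 1 ζ x) = if m = n then (1 : ℝ) else 0)
    (z0 z1 : ℕ → ℕ → ℝ)
    (hzfac0 : ∀ n, P0 n = C (lc0 n) * ∏ i ∈ Finset.Icc 1 n, (X - C (z0 n i)))
    (hzfac1 : ∀ n, P1 n = C (lc1 n) * ∏ i ∈ Finset.Icc 1 n, (X - C (z1 n i)))
    (hzgt0 : ∀ n i, 1 ≤ i → i ≤ n → 1 < z0 n i)
    (hzgt1 : ∀ n i, 1 ≤ i → i ≤ n → 1 < z1 n i)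
    (hzmono0 : ∀ n i j, 1 ≤ i → i < j → j ≤ n → z0 n i < z0 n j)
    (hzmono1 : ∀ n i j, 1 ≤ i → i < j → j ≤ n → z1 n i < z1 n j)
    :
    ∀ n : ℕ, 1 ≤ n →
      (1 < z0 (n + 1) 1 ∧
        ∀ i, 1 ≤ i → i ≤ n →
          z0 (n + 1) i < z1 n i ∧ z1 n i < z0 (n + 1) (i + 1)) := by
  have hne0 : ∀ n, P0 n ≠ 0 := fun n h => by
    have := hlc0pos n
    rw [← hlc0, h, leadingCoeff_zero] at this
    exact lt_irrefl _ this
  have hne1 : ∀ n, P1 n ≠ 0 := fun n h => by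
    have := hlc1pos n
    rw [← hlc1, h, leadingCoeff_zero] at this
    exact lt_irrefl _ this
  have hint := integrable_eval_mul hdeg0 hne0 (μ := volume.restrict (Set.Ioi 1))
    (measurable_wgt 0 ζ)
    ((ae_restrict_mem measurableSet_Ioi).mono fun x hx => wgt_nonneg 0 ζ hx)
    (fun n => by simpa using horth0 n n)
  let L : ℝ[X] →ₗ[ℝ] ℝ :=
    { toFun := fun p => ∫ x in Set.Ioi (1 : ℝ), p.eval x * wgt 0 ζ x
      map_add' := fun p q => by
        simp only [eval_add, add_mul]
        exact integral_add (hint p) (hint q)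
      map_smul' := fun c p => by
        simp only [eval_smul, smul_eq_mul, mul_assoc, RingHom.id_apply]
        exact integral_const_mul _ _ }
  have hL0 : ∀ m n, L (P0 m * P0 n) = if m = n then 1 else 0 := by
    intro m n
    rw [← horth0]
    simp only [L, LinearMap.coe_mk, AddHom.coe_mk, eval_mul]
  have hL1 : ∀ m n, L ((X ^ 2 - 1) * (P1 m * P1 n)) = if m = n then 1 else 0 := by
    intro m n
    rw [← horth1]
    simp only [L, LinearMap.coe_mk, AddHom.coe_mk]
    refine setIntegral_congr_fun measurableSet_Ioi fun x hx => ?_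
    simp only [wgt_one_eq ζ hx, eval_mul, eval_sub, eval_pow, eval_X, eval_one]
    ring
  intro n hn
  refine ⟨hzgt0 (n + 1) 1 le_rfl (by omega),
    interlace_of_mem_gaps (hzmono1 n) fun i hi hin => ?_⟩
  have hsign := eval_mul_eval_neg_of_orthogonal L (map_mul_self_pos hdeg0 hne0 L hL0)
    (hzmono0 (n + 1)) (w := X ^ 2 - 1) (hlc0pos (n + 1)) (hzfac0 (n + 1)) (hdeg0 (n + 1))
    (by simpa using natDegree_X_pow_sub_C (n := 2) (r := (1 : ℝ))) (hdeg1 n) (hne1 n)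
    (fun i h1 h2 => by
      have := hzgt0 (n + 1) i h1 h2
      simp only [eval_sub, eval_pow, eval_X, eval_one]
      nlinarith)
    (map_mul_eq_zero_of_degree_lt hdeg0 hne0 L (fun m n h => by simp [hL0, h]) (n + 1))
    (map_mul_eq_zero_of_degree_lt hdeg1 hne1 (L.comp (LinearMap.mulLeft ℝ (X ^ 2 - 1)))
      (fun m n h => by simp [hL1, h]) n) hi hin
  have hlt := hzmono0 (n + 1) i (i + 1) hi (by omega) (by omega)
  obtain ⟨x, hx, hx0⟩ : ∃ x ∈ Set.Ioo (z0 (n + 1) i) (z0 (n + 1) (i + 1)),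
      (P1 n).eval x = 0 := by
    rcases mul_neg_iff.mp hsign with h | h
    · exact intermediate_value_Ioo' hlt.le (P1 n).continuous.continuousOn ⟨h.2, h.1⟩
    · exact intermediate_value_Ioo hlt.le (P1 n).continuous.continuousOn ⟨h.1, h.2⟩
  rw [hzfac1 n, eval_C_mul_prod, mul_eq_zero, Finset.prod_eq_zero_iff] at hx0
  obtain ⟨j, hj, hxj⟩ := hx0.resolve_left (hlc1pos n).ne'
  rw [Finset.mem_Icc] at hj
  rw [sub_eq_zero] at hxj
  subst hxj
  exact ⟨j, hj.1, hj.2, hx.1, hx.2⟩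
end

section
/- All of the quantities p_n, q_n, r_n, p̃_n, q̃_n and r̃_n are strictly positive (for all indices n for which they are defined: p_n, q_n, p̃_n, q̃_n, r̃_n for n ≥ 0 and r_n for n ≥ 1). -/
open MeasureTheory Polynomial

/-- Orthonormality of a graded polynomial sequence with respect to a linear functional. -/
structure IsOrthonormalSeq (L : ℝ[X] →ₗ[ℝ] ℝ) (P : ℕ → ℝ[X]) (c : ℕ → ℝ) : Prop where
  natDegree_eq : ∀ n, (P n).natDegree = n
  leadingCoeff_eq : ∀ n, (P n).leadingCoeff = c n
  pos : ∀ n, 0 < c n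
  orth : ∀ m n, L (P m * P n) = if m = n then 1 else 0

namespace IsOrthonormalSeq

variable {L : ℝ[X] →ₗ[ℝ] ℝ} {P : ℕ → ℝ[X]} {c : ℕ → ℝ}

theorem coeff_self (h : IsOrthonormalSeq L P c) (n : ℕ) : (P n).coeff n = c n := by
  rw [← h.leadingCoeff_eq n, leadingCoeff, h.natDegree_eq]

theorem coeff_of_lt (h : IsOrthonormalSeq L P c) {m n : ℕ} (hmn : n < m) :
    (P n).coeff m = 0 :=
  coeff_eq_zero_of_natDegree_lt (by rwa [h.natDegree_eq])

theorem exists_eq_sum (h : IsOrthonormalSeq L P c) (m : ℕ) (F : ℝ[X])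
    (hF : ∀ k, m ≤ k → F.coeff k = 0) :
    ∃ a : ℕ → ℝ, F = ∑ k ∈ Finset.range m, a k • P k := by
  induction m generalizing F with
  | zero => exact ⟨0, by ext k; simpa using hF k (Nat.zero_le k)⟩
  | succ m ih =>
    obtain ⟨a, ha⟩ := ih (F - (F.coeff m / c m) • P m) (by
      intro k hk
      rcases hk.eq_or_lt with rfl | hk
      · simp [h.coeff_self, (h.pos m).ne']
      · simp [h.coeff_of_lt hk, hF k hk])
    refine ⟨Function.update a m (F.coeff m / c m), ?_⟩
    rw [Finset.sum_range_succ, Function.update_self, ← sub_eq_iff_eq_add, ha]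
    refine Finset.sum_congr rfl fun k hk => ?_
    rw [Function.update_of_ne (Finset.mem_range.1 hk).ne]

theorem map_sum_mul (h : IsOrthonormalSeq L P c) (s : Finset ℕ) (a : ℕ → ℝ) (n : ℕ) :
    L ((∑ k ∈ s, a k • P k) * P n) = if n ∈ s then a n else 0 := by
  simp [Finset.sum_mul, h.orth]

theorem eq_sum (h : IsOrthonormalSeq L P c) (m : ℕ) (F : ℝ[X])
    (hF : ∀ k, m ≤ k → F.coeff k = 0) :
    F = ∑ k ∈ Finset.range m, L (F * P k) • P k := by
  obtain ⟨a, rfl⟩ := h.exists_eq_sum m F hF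
  refine Finset.sum_congr rfl fun k hk => ?_
  rw [h.map_sum_mul, if_pos hk]

/-- Pairing with `P n` reads off the top coefficient of a polynomial of degree at most `n`. -/
theorem map_mul (h : IsOrthonormalSeq L P c) (n : ℕ) (F : ℝ[X])
    (hF : ∀ k, n < k → F.coeff k = 0) : L (F * P n) = F.coeff n / c n := by
  have h1 := h.eq_sum (n + 1) F hF
  have h2 : F.coeff n = L (F * P n) * c n := by
    conv_lhs => rw [h1]
    rw [Finset.sum_range_succ, coeff_add, finsetSum_coeff, Finset.sum_eq_zero]
    · simp [h.coeff_self]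
    · intro k hk
      simp [h.coeff_of_lt (Finset.mem_range.1 hk)]
  rw [h2, mul_div_cancel_right₀ _ (h.pos n).ne']

theorem three_term (h : IsOrthonormalSeq L P c) (n : ℕ) :
    ∃ a : ℝ, X * P (n + 1) =
      (c n / c (n + 1)) • P n + a • P (n + 1) + (c (n + 1) / c (n + 2)) • P (n + 2) := by
  have hX : ∀ k j, k + 1 < j → (X * P k).coeff j = 0 := by
    intro k j hj
    obtain ⟨i, rfl⟩ := Nat.exists_eq_succ_of_ne_zero (show j ≠ 0 by omega)
    rw [coeff_X_mul, h.coeff_of_lt (by omega)]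
  have hlow : ∀ k, L (X * P (n + 1) * P k) = L (X * P k * P (n + 1)) := by
    intro k
    congr 1
    ring
  have h1 := h.eq_sum (n + 3) (X * P (n + 1)) (fun k hk => hX _ _ (by omega))
  rw [Finset.sum_range_succ, Finset.sum_range_succ, Finset.sum_range_succ,
    Finset.sum_eq_zero, zero_add, hlow n, h.map_mul (n + 1) _ (hX n),
    h.map_mul (n + 2) _ (hX (n + 1)), coeff_X_mul, coeff_X_mul, h.coeff_self, h.coeff_self] at h1
  · exact ⟨_, h1⟩
  · intro k hk
    have hk := Finset.mem_range.1 hk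
    rw [hlow k, h.map_mul (n + 1) _ (fun j hj => hX k j (by omega)), hX k _ (by omega)]
    simp

end IsOrthonormalSeq

theorem coeff_sq_sub_one_mul (F : ℝ[X]) (k : ℕ) :
    ((X ^ 2 - 1) * F).coeff (k + 2) = F.coeff k - F.coeff (k + 2) := by
  rw [sub_mul, coeff_sub, coeff_X_pow_mul, one_mul]

/-- Expansion of `(X² - 1) P1 n` when `P1` is orthonormal for the functional multiplied by
`X² - 1`. -/
theorem sq_sub_one_mul_eq {L L' : ℝ[X] →ₗ[ℝ] ℝ} {P0 P1 : ℕ → ℝ[X]} {c0 c1 : ℕ → ℝ}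
    (h0 : IsOrthonormalSeq L P0 c0) (h1 : IsOrthonormalSeq L' P1 c1)
    (hL : ∀ F, L' F = L ((X ^ 2 - 1) * F)) (n : ℕ) :
    (X ^ 2 - 1) * P1 n = (c0 n / c1 n) • P0 n + L' (P0 (n + 1) * P1 n) • P0 (n + 1)
      + (c1 n / c0 (n + 2)) • P0 (n + 2) := by
  have htop : ∀ k, n + 2 < k → ((X ^ 2 - 1) * P1 n).coeff k = 0 := by
    intro k hk
    obtain ⟨i, rfl⟩ := Nat.exists_eq_add_of_le' (show 2 ≤ k by omega)
    rw [coeff_sq_sub_one_mul, h1.coeff_of_lt (by omega), h1.coeff_of_lt (by omega), sub_zero]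
  have hlow : ∀ k, L ((X ^ 2 - 1) * P1 n * P0 k) = L' (P0 k * P1 n) := by
    intro k
    rw [hL]
    congr 1
    ring
  have h := h0.eq_sum (n + 3) ((X ^ 2 - 1) * P1 n) (fun k hk => htop k (by omega))
  rw [Finset.sum_range_succ, Finset.sum_range_succ, Finset.sum_range_succ,
    Finset.sum_eq_zero, zero_add, hlow n, hlow (n + 1),
    h1.map_mul n (P0 n) (fun k hk => h0.coeff_of_lt hk), h0.coeff_self,
    h0.map_mul (n + 2) _ htop, coeff_sq_sub_one_mul, h1.coeff_self,
    h1.coeff_of_lt (by omega), sub_zero] at h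
  · exact h
  · intro k hk
    have hk := Finset.mem_range.1 hk
    rw [hlow k, h1.map_mul n (P0 k) (fun j hj => h0.coeff_of_lt (by omega)), h0.coeff_of_lt hk]
    simp

theorem coeff_prod_X_sub_C (n : ℕ) (z : ℕ → ℝ) :
    (∏ i ∈ Finset.Icc 1 (n + 1), (X - C (z i))).coeff n = -∑ i ∈ Finset.Icc 1 (n + 1), z i := by
  have h := prod_X_sub_C_coeff_card_pred (Finset.Icc 1 (n + 1)) z (by simp)
  simpa using h

theorem neg_one_pow_mul_eval_pos {P : ℝ[X]} {c : ℝ} {n : ℕ} {z : ℕ → ℝ} (hc : 0 < c)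
    (hP : P = C c * ∏ i ∈ Finset.Icc 1 n, (X - C (z i)))
    (hz : ∀ i, 1 ≤ i → i ≤ n → 1 < z i) {y : ℝ} (hy : y ≤ 1) :
    0 < (-1) ^ n * P.eval y := by
  have h : (-1) ^ n * P.eval y = c * ∏ i ∈ Finset.Icc 1 n, (z i - y) := by
    have h2 : ∏ i ∈ Finset.Icc 1 n, (z i - y) = (-1) ^ n * ∏ i ∈ Finset.Icc 1 n, (y - z i) := by
      have := Finset.prod_neg (s := Finset.Icc 1 n) (f := fun i => y - z i)
      simpa using this
    rw [hP, eval_mul, eval_C, eval_prod, h2]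
    simp only [eval_sub, eval_X, eval_C]
    ring
  rw [h]
  refine mul_pos hc (Finset.prod_pos fun i hi => ?_)
  rw [Finset.mem_Icc] at hi
  linarith [hz i hi.1 hi.2]

/-- The Christoffel–Darboux kernel at `(1, -1)` is positive. -/
theorem christoffelDarboux_pos {L : ℝ[X] →ₗ[ℝ] ℝ} {P : ℕ → ℝ[X]} {c : ℕ → ℝ}
    (h : IsOrthonormalSeq L P c)
    (hs : ∀ n, 0 < (-1) ^ n * (P n).eval 1) (hm : ∀ n, 0 < (-1) ^ n * (P n).eval (-1)) (n : ℕ) :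
    0 < (P (n + 1)).eval 1 * (P n).eval (-1) - (P (n + 1)).eval (-1) * (P n).eval 1 := by
  induction n with
  | zero =>
    have e0 : P 0 = C (c 0) := by
      rw [eq_C_of_natDegree_eq_zero (h.natDegree_eq 0), h.coeff_self]
    have e1 : P 1 = C (c 1) * X + C ((P 1).coeff 0) := by
      conv_lhs => rw [eq_X_add_C_of_natDegree_le_one (h.natDegree_eq 1).le, h.coeff_self]
    rw [zero_add, e0, e1]
    simp only [eval_add, eval_mul, eval_C, eval_X]
    nlinarith [mul_pos (h.pos 0) (h.pos 1)]
  | succ n ih =>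
    obtain ⟨a, ha⟩ := h.three_term n
    have e1 := congrArg (eval 1) ha
    have e2 := congrArg (eval (-1)) ha
    simp only [eval_add, eval_mul, eval_X, eval_smul, smul_eq_mul] at e1 e2
    have hb := div_pos (h.pos n) (h.pos (n + 1))
    have hb' := div_pos (h.pos (n + 1)) (h.pos (n + 2))
    set b := c n / c (n + 1)
    set b' := c (n + 1) / c (n + 2)
    have hprod : 0 < (P (n + 1)).eval 1 * (P (n + 1)).eval (-1) := by
      have := mul_pos (hs (n + 1)) (hm (n + 1))
      rwa [mul_mul_mul_comm, ← mul_pow, neg_one_mul, neg_neg, one_pow, one_mul] at this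
    refine pos_of_mul_pos_right (a := b') ?_ hb'.le
    have key : b' * ((P (n + 2)).eval 1 * (P (n + 1)).eval (-1)
          - (P (n + 2)).eval (-1) * (P (n + 1)).eval 1)
        = 2 * ((P (n + 1)).eval 1 * (P (n + 1)).eval (-1))
          + b * ((P (n + 1)).eval 1 * (P n).eval (-1) - (P (n + 1)).eval (-1) * (P n).eval 1) := by
      linear_combination (-(P (n + 1)).eval (-1)) * e1 + (P (n + 1)).eval 1 * e2
    rw [key]
    have := mul_pos hb ih
    linarith

/-- If `(X² - 1) Q = t (X + d) F + r G` and the signs at `±1` alternate, then `d, r > 0`. -/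
theorem pos_of_eval_eq {t d r s s' m m' : ℝ} (ht : 0 < t)
    (hs : 0 < s) (hs' : 0 < s') (hm : 0 < m) (hm' : 0 < m')
    (e1 : r * s = t * (1 + d) * s') (e2 : r * m = t * (d - 1) * m')
    (hE : 0 < m' * s - s' * m) : 0 < d ∧ 0 < r := by
  have key : d * (m' * s - s' * m) = s' * m + m' * s := by
    have : t * (d * (m' * s - s' * m)) = t * (s' * m + m' * s) := by
      linear_combination m * e1 - s * e2
    exact mul_left_cancel₀ ht.ne' this
  have hd : 0 < d := by
    refine pos_of_mul_pos_left (b := m' * s - s' * m) ?_ hE.le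
    rw [key]
    positivity
  refine ⟨hd, pos_of_mul_pos_left (b := s) ?_ hs.le⟩
  rw [e1]
  positivity

/-- Integrability of all polynomial moments from normalisability of the `P n`. -/
theorem integrable_eval_mul_wgt (ℓ : ℕ) (ζ : ℝ) (P : ℕ → ℝ[X]) (hdeg : ∀ n, (P n).natDegree = n)
    (hne : ∀ n, (P n).leadingCoeff ≠ 0)
    (hint : ∀ n, ∫ x in Set.Ioi (1 : ℝ), (P n).eval x * (P n).eval x * wgt ℓ ζ x = 1)
    (F : ℝ[X]) : IntegrableOn (fun x => F.eval x * wgt ℓ ζ x) (Set.Ioi 1) := by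
  have hsq : ∀ n, IntegrableOn (fun x => (P n).eval x * (P n).eval x * wgt ℓ ζ x)
      (Set.Ioi 1) := by
    intro n
    by_contra hn
    have := hint n
    rw [integral_undef hn] at this
    exact zero_ne_one this
  have hP0 : P 0 = C (P 0).leadingCoeff := by
    conv_lhs => rw [eq_C_of_natDegree_eq_zero (hdeg 0)]
    rw [leadingCoeff, hdeg]
  have hw : IntegrableOn (wgt ℓ ζ) (Set.Ioi 1) := by
    have h := (hsq 0).const_mul ((P 0).leadingCoeff * (P 0).leadingCoeff)⁻¹
    refine (integrable_congr (Filter.Eventually.of_forall fun x => ?_)).1 h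
    have he : (P 0).eval x = (P 0).leadingCoeff := by
      conv_lhs => rw [hP0, eval_C]
    have := hne 0
    simp only [he]
    field_simp
  have hP : ∀ n, IntegrableOn (fun x => (P n).eval x * wgt ℓ ζ x) (Set.Ioi 1) := by
    intro n
    refine Integrable.mono' (hw.add (hsq n))
      (((P n).continuous.measurable.mul (measurable_wgt ℓ ζ)).aestronglyMeasurable) ?_
    refine (ae_restrict_mem measurableSet_Ioi).mono fun x hx => ?_
    have hx' := wgt_nonneg ℓ ζ (Set.mem_Ioi.1 hx)
    rw [Real.norm_eq_abs, abs_mul, abs_of_nonneg hx']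
    have : |(P n).eval x| ≤ 1 + (P n).eval x * (P n).eval x := by
      rw [abs_le]
      constructor <;> nlinarith [sq_nonneg ((P n).eval x + 1), sq_nonneg ((P n).eval x - 1)]
    simp only [Pi.add_apply]
    nlinarith [mul_le_mul_of_nonneg_right this hx']
  induction hN : F.natDegree using Nat.strong_induction_on generalizing F with
  | _ N ih =>
    set a := F.coeff N / (P N).leadingCoeff with ha
    have hG : IntegrableOn (fun x => (F - a • P N).eval x * wgt ℓ ζ x) (Set.Ioi 1) := by
      have hzero : ∀ k, N ≤ k → (F - a • P N).coeff k = 0 := by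
        intro k hk
        rcases hk.eq_or_lt with rfl | hk
        · have hl : (P N).coeff N = (P N).leadingCoeff := by rw [leadingCoeff, hdeg]
          simp [ha, hl, hne N]
        · simp [coeff_eq_zero_of_natDegree_lt (hN ▸ hk : F.natDegree < k),
            coeff_eq_zero_of_natDegree_lt ((hdeg N).symm ▸ hk : (P N).natDegree < k)]
      rcases Nat.eq_zero_or_pos N with h0 | h0
      · have : F - a • P N = 0 := by
          ext k
          simpa using hzero k (by omega)
        simp [this]
      · refine ih _ ?_ _ rfl
        rw [← Nat.le_sub_one_iff_lt h0, natDegree_le_iff_coeff_eq_zero]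
        intro k hk
        exact hzero k (by omega)
    refine (integrable_congr (Filter.Eventually.of_forall fun x => ?_)).1
      (hG.add ((hP N).const_mul a))
    simp only [Pi.add_apply, eval_sub, eval_smul, smul_eq_mul]
    ring

/-- Integration of polynomials against a weight with finite moments. -/
noncomputable def momentFunctional (w : ℝ → ℝ)
    (hw : ∀ F : ℝ[X], IntegrableOn (fun x => F.eval x * w x) (Set.Ioi 1)) : ℝ[X] →ₗ[ℝ] ℝ where
  toFun F := ∫ x in Set.Ioi (1 : ℝ), F.eval x * w x
  map_add' F G := by
    rw [← integral_add (hw F) (hw G)]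
    simp only [eval_add, add_mul]
  map_smul' a F := by
    rw [RingHom.id_apply, smul_eq_mul, ← integral_const_mul]
    simp only [eval_smul, smul_eq_mul, mul_assoc]

theorem stmt12
    (ζ : ℝ) (hζ : 0 < ζ)
    (P0 P1 : ℕ → Polynomial ℝ) (lc0 lc1 : ℕ → ℝ)
    (hdeg0 : ∀ n, (P0 n).natDegree = n)
    (hdeg1 : ∀ n, (P1 n).natDegree = n)
    (hlc0 : ∀ n, (P0 n).leadingCoeff = lc0 n)
    (hlc1 : ∀ n, (P1 n).leadingCoeff = lc1 n)
    (hlc0pos : ∀ n, 0 < lc0 n)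
    (hlc1pos : ∀ n, 0 < lc1 n)
    (horth0 : ∀ m n, (∫ x in Set.Ioi (1 : ℝ),
        (P0 m).eval x * (P0 n).eval x * wgt 0 ζ x) = if m = n then (1 : ℝ) else 0)
    (horth1 : ∀ m n, (∫ x in Set.Ioi (1 : ℝ),
        (P1 m).eval x * (P1 n).eval x * wgt 1 ζ x) = if m = n then (1 : ℝ) else 0)
    (z0 z1 : ℕ → ℕ → ℝ)
    (hzfac0 : ∀ n, P0 n = C (lc0 n) * ∏ i ∈ Finset.Icc 1 n, (X - C (z0 n i)))
    (hzfac1 : ∀ n, P1 n = C (lc1 n) * ∏ i ∈ Finset.Icc 1 n, (X - C (z1 n i)))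
    (hzgt0 : ∀ n i, 1 ≤ i → i ≤ n → 1 < z0 n i)
    (hzgt1 : ∀ n i, 1 ≤ i → i ≤ n → 1 < z1 n i)
    (hzmono0 : ∀ n i j, 1 ≤ i → i < j → j ≤ n → z0 n i < z0 n j)
    (hzmono1 : ∀ n i j, 1 ≤ i → i < j → j ≤ n → z1 n i < z1 n j)
    (p q r pt qt rt : ℕ → ℝ)
    (hp : ∀ n, p n = lc0 n / lc1 n)
    (hr : ∀ n, r (n + 1) = lc1 n / lc0 (n + 2))
    (hq : ∀ n, q n = ∫ x in Set.Ioi (1 : ℝ),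
        (P0 (n + 1)).eval x * (P1 n).eval x * wgt 1 ζ x)
    (hpt : ∀ n, pt n = lc1 n / lc0 (n + 1))
    (hqt : ∀ n, qt n = (∑ i ∈ Finset.Icc 1 (n + 1), z0 (n + 1) i)
      - ∑ i ∈ Finset.Icc 1 n, z1 n i)
    (hrt : ∀ n, rt n = p n * (1 - (pt n) ^ 2)) :
    (∀ n, 0 < p n) ∧ (∀ n, 0 < q n) ∧ (∀ n, 0 < r (n + 1)) ∧
    (∀ n, 0 < pt n) ∧ (∀ n, 0 < qt n) ∧ (∀ n, 0 < rt n) := by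
  have hw0 := integrable_eval_mul_wgt 0 ζ P0 hdeg0 (fun n => hlc0 n ▸ (hlc0pos n).ne')
    (fun n => by rw [horth0, if_pos rfl])
  have hw1 := integrable_eval_mul_wgt 1 ζ P1 hdeg1 (fun n => hlc1 n ▸ (hlc1pos n).ne')
    (fun n => by rw [horth1, if_pos rfl])
  set L := momentFunctional _ hw0 with hLdef
  set L' := momentFunctional _ hw1 with hLdef'
  have h0 : IsOrthonormalSeq L P0 lc0 := ⟨hdeg0, hlc0, hlc0pos, fun m n => by
    rw [← horth0 m n]
    simp [hLdef, momentFunctional]⟩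
  have h1 : IsOrthonormalSeq L' P1 lc1 := ⟨hdeg1, hlc1, hlc1pos, fun m n => by
    rw [← horth1 m n]
    simp [hLdef', momentFunctional]⟩
  have hL : ∀ F, L' F = L ((X ^ 2 - 1) * F) := by
    intro F
    refine setIntegral_congr_fun measurableSet_Ioi fun x hx => ?_
    simp only [wgt_one_eq ζ (Set.mem_Ioi.1 hx), eval_mul, eval_sub, eval_pow, eval_X, eval_one]
    ring
  have hs : ∀ n, 0 < (-1) ^ n * (P0 n).eval 1 := fun n =>
    neg_one_pow_mul_eval_pos (hlc0pos n) (hzfac0 n) (hzgt0 n) le_rfl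
  have hm : ∀ n, 0 < (-1) ^ n * (P0 n).eval (-1) := fun n =>
    neg_one_pow_mul_eval_pos (hlc0pos n) (hzfac0 n) (hzgt0 n) (by norm_num)
  have hp_pos : ∀ n, 0 < p n := fun n => hp n ▸ div_pos (hlc0pos n) (hlc1pos n)
  have hr_pos : ∀ n, 0 < r (n + 1) := fun n => hr n ▸ div_pos (hlc1pos n) (hlc0pos _)
  have hpt_pos : ∀ n, 0 < pt n := fun n => hpt n ▸ div_pos (hlc1pos n) (hlc0pos _)
  have hexp : ∀ n, (X ^ 2 - 1) * P1 n
      = p n • P0 n + q n • P0 (n + 1) + r (n + 1) • P0 (n + 2) := by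
    intro n
    have hqL : q n = L' (P0 (n + 1) * P1 n) := by
      rw [hq]
      simp [hLdef', momentFunctional]
    rw [hp, hr, hqL]
    exact sq_sub_one_mul_eq h0 h1 hL n
  have hq_pos : ∀ n, 0 < q n := by
    intro n
    have e := congrArg (eval 1) (hexp n)
    simp only [eval_add, eval_mul, eval_sub, eval_pow, eval_X, eval_one, eval_smul,
      smul_eq_mul] at e
    refine pos_of_mul_pos_left (b := (-1) ^ (n + 1) * (P0 (n + 1)).eval 1) ?_ (hs (n + 1)).le
    have e' : q n * ((-1) ^ (n + 1) * (P0 (n + 1)).eval 1)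
        = p n * ((-1) ^ n * (P0 n).eval 1)
          + r (n + 1) * ((-1) ^ (n + 2) * (P0 (n + 2)).eval 1) := by
      rw [pow_succ, pow_add]
      linear_combination (-1) ^ n * e
    rw [e']
    exact add_pos (mul_pos (hp_pos n) (hs n)) (mul_pos (hr_pos n) (hs (n + 2)))
  have hmixed : ∀ n, (X ^ 2 - 1) * P1 n
      = pt n • ((X + C (qt n)) * P0 (n + 1)) + rt n • P0 n := by
    intro n
    obtain ⟨a, ha⟩ := h0.three_term n
    have c0 := (hlc0pos n).ne'
    have c1 := (hlc0pos (n + 1)).ne'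
    have c2 := (hlc0pos (n + 2)).ne'
    have d0 := (hlc1pos n).ne'
    have hr' : r (n + 1) = pt n * (lc0 (n + 1) / lc0 (n + 2)) := by
      rw [hr, hpt]
      field_simp
    have hrt' : rt n = p n - pt n * (lc0 n / lc0 (n + 1)) := by
      rw [hrt, hp, hpt]
      field_simp
    have e : (X ^ 2 - 1) * P1 n = pt n • (X * P0 (n + 1)) + rt n • P0 n
        + (q n - pt n * a) • P0 (n + 1) := by
      rw [hexp, ha, hr', hrt']
      module
    have htop0 : (P0 (n + 1)).coeff n
        = lc0 (n + 1) * -∑ i ∈ Finset.Icc 1 (n + 1), z0 (n + 1) i := by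
      rw [hzfac0, coeff_C_mul, coeff_prod_X_sub_C]
    have htop1 : ((X ^ 2 - 1) * P1 n).coeff (n + 1)
        = lc1 n * -∑ i ∈ Finset.Icc 1 n, z1 n i := by
      cases n with
      | zero =>
        have : P1 0 = C (lc1 0) := by simpa using hzfac1 0
        simp [this, sub_mul]
      | succ k =>
        rw [coeff_sq_sub_one_mul, h1.coeff_of_lt (show k + 1 < k + 2 by omega), sub_zero, hzfac1,
          coeff_C_mul,
          coeff_prod_X_sub_C]
    have ec := congrArg (fun F => coeff F (n + 1)) e
    simp only [htop1, coeff_add, coeff_smul, coeff_X_mul, smul_eq_mul, htop0, h0.coeff_self,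
      h0.coeff_of_lt (Nat.lt_succ_self n)] at ec
    have hcoef : q n - pt n * a = pt n * qt n := by
      have hpl : pt n * lc0 (n + 1) = lc1 n := by
        rw [hpt]
        field_simp
      apply mul_right_cancel₀ c1
      rw [hqt]
      linear_combination (-1 : ℝ) * ec + (∑ i ∈ Finset.Icc 1 n, z1 n i) * hpl
    rw [e, hcoef, add_mul, ← smul_eq_C_mul]
    module
  have hmain : ∀ n, 0 < qt n ∧ 0 < rt n := by
    intro n
    have e1 := congrArg (eval 1) (hmixed n)
    have e2 := congrArg (eval (-1)) (hmixed n)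
    simp only [eval_add, eval_mul, eval_sub, eval_pow, eval_X, eval_one, eval_smul, eval_C,
      smul_eq_mul] at e1 e2
    have hE := christoffelDarboux_pos h0 hs hm n
    have hsq : ((-1 : ℝ) ^ n) * (-1) ^ n = 1 := by
      rw [← mul_pow]
      norm_num
    refine pos_of_eval_eq (hpt_pos n) (hs n) (hs (n + 1)) (hm n) (hm (n + 1)) ?_ ?_ ?_
    · rw [pow_succ]
      linear_combination (-(-1) ^ n) * e1
    · rw [pow_succ]
      linear_combination (-(-1) ^ n) * e2
    · convert hE using 1
      rw [pow_succ]
      linear_combination ((P0 (n + 1)).eval 1 * (P0 n).eval (-1)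
        - (P0 (n + 1)).eval (-1) * (P0 n).eval 1) * hsq
  exact ⟨hp_pos, hq_pos, hr_pos, hpt_pos, fun n => (hmain n).1, fun n => (hmain n).2⟩
end

section
/- For ℓ ∈ {0,1}, every n ≥ 1 and every 1 ≤ i ≤ n, the i-th zero x_{i,n}^(ℓ)(ζ) of P_n^(ℓ)(·;ζ) is a differentiable, strictly decreasing function of ζ on (0,∞): ∂x_{i,n}^(ℓ)/∂ζ < 0. -/
open MeasureTheory Polynomial

open ProbabilityTheory Filter Topology

/-- The linear functional `f ↦ ∫ f(x) e^{s x} dμ(x)` on real polynomials. -/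
noncomputable def expMoment (μ : Measure ℝ) (s : ℝ) (f : ℝ[X]) : ℝ :=
  ∫ x, f.eval x * Real.exp (s * x) ∂μ

section ExpMoment

variable {μ : Measure ℝ} {s : ℝ}

lemma integrable_eval_mul_exp (hs : s ∈ interior (integrableExpSet id μ)) (f : ℝ[X]) :
    Integrable (fun x => f.eval x * Real.exp (s * x)) μ := by
  induction f using Polynomial.induction_on' with
  | add p q hp hq => simp only [eval_add, add_mul]; exact hp.add hq
  | monomial k a =>
    simpa [mul_assoc] using
      (integrable_pow_mul_exp_of_mem_interior_integrableExpSet hs k).const_mul a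

lemma expMoment_add (hs : s ∈ interior (integrableExpSet id μ)) (f g : ℝ[X]) :
    expMoment μ s (f + g) = expMoment μ s f + expMoment μ s g := by
  simp only [expMoment, eval_add, add_mul]
  exact integral_add (integrable_eval_mul_exp hs f) (integrable_eval_mul_exp hs g)

lemma expMoment_C_mul (a : ℝ) (f : ℝ[X]) :
    expMoment μ s (C a * f) = a * expMoment μ s f := by
  simp only [expMoment, eval_mul, eval_C, mul_assoc]
  exact integral_const_mul _ _

lemma expMoment_zero : expMoment μ s 0 = 0 := by simp [expMoment]

lemma expMoment_sum (hs : s ∈ interior (integrableExpSet id μ)) {ι : Type*} (S : Finset ι)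
    (f : ι → ℝ[X]) : expMoment μ s (∑ i ∈ S, f i) = ∑ i ∈ S, expMoment μ s (f i) := by
  classical
  induction S using Finset.induction_on with
  | empty => simp [expMoment_zero]
  | insert i S hi ih => rw [Finset.sum_insert hi, Finset.sum_insert hi, expMoment_add hs, ih]

lemma expMoment_mul_self_nonneg (f : ℝ[X]) : 0 ≤ expMoment μ s (f * f) := by
  refine integral_nonneg fun x => ?_
  simpa using mul_nonneg (mul_self_nonneg (f.eval x)) (Real.exp_pos _).le

lemma hasDerivAt_expMoment (hs : s ∈ interior (integrableExpSet id μ)) (f : ℝ[X]) :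
    HasDerivAt (fun t => expMoment μ t f) (expMoment μ s (X * f)) s := by
  induction f using Polynomial.induction_on' with
  | add p q hp hq =>
    rw [mul_add, expMoment_add hs]
    refine (hp.add hq).congr_of_eventuallyEq ?_
    filter_upwards [isOpen_interior.mem_nhds hs] with t ht
    exact expMoment_add ht p q
  | monomial k a =>
    have h := (hasDerivAt_integral_pow_mul_exp_real hs k).const_mul a
    have h1 : ∀ t, expMoment μ t (monomial k a) = a * ∫ x, x ^ k * Real.exp (t * x) ∂μ := by
      intro t
      rw [← integral_const_mul]
      simp [expMoment, mul_assoc]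
    have h2 : expMoment μ s (X * monomial k a)
        = a * ∫ x, x ^ (k + 1) * Real.exp (s * x) ∂μ := by
      rw [← integral_const_mul]
      refine integral_congr_ae (Eventually.of_forall fun x => ?_)
      simp only [eval_mul, eval_X, eval_monomial]
      ring
    rw [h2]
    simpa only [h1, id] using h

/-- Product rule for the functional applied to a differentiable family of polynomials. -/
lemma hasDerivAt_expMoment_sum_mul (hs : s ∈ interior (integrableExpSet id μ)) (N : ℕ)
    (c : ℝ → ℕ → ℝ) (c' : ℕ → ℝ) (hc : ∀ k, HasDerivAt (fun t => c t k) (c' k) s) (f : ℝ[X]) :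
    HasDerivAt (fun t => expMoment μ t ((∑ k ∈ Finset.range N, C (c t k) * X ^ k) * f))
      (expMoment μ s ((∑ k ∈ Finset.range N, C (c' k) * X ^ k) * f)
        + expMoment μ s (X * ((∑ k ∈ Finset.range N, C (c s k) * X ^ k) * f))) s := by
  have key : ∀ t ∈ interior (integrableExpSet id μ), ∀ (d : ℕ → ℝ) (g : ℝ[X]),
      expMoment μ t ((∑ k ∈ Finset.range N, C (d k) * X ^ k) * g)
        = ∑ k ∈ Finset.range N, d k * expMoment μ t (X ^ k * g) := by
    intro t ht d g
    rw [Finset.sum_mul, expMoment_sum ht]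
    exact Finset.sum_congr rfl fun k _ => by rw [mul_assoc, expMoment_C_mul]
  have h := HasDerivAt.fun_sum (u := Finset.range N) fun k _ =>
    (hc k).mul (hasDerivAt_expMoment hs (X ^ k * f))
  have e : (X : ℝ[X]) * ((∑ k ∈ Finset.range N, C (c s k) * X ^ k) * f)
      = (∑ k ∈ Finset.range N, C (c s k) * X ^ k) * (X * f) := by ring
  rw [e, key s hs, key s hs, ← Finset.sum_add_distrib]
  simp only [mul_left_comm (X : ℝ[X]) (X ^ _) f] at h
  refine h.congr_of_eventuallyEq ?_
  filter_upwards [isOpen_interior.mem_nhds hs] with t ht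
  exact key t ht (c t) f

/-- A member of an orthogonal sequence annihilates all polynomials of lower degree. -/
lemma expMoment_mul_eq_zero_of_degree_lt (hs : s ∈ interior (integrableExpSet id μ))
    {P : ℕ → ℝ[X]} (hdeg : ∀ n, (P n).natDegree = n) (hne : ∀ n, P n ≠ 0) {n : ℕ}
    (horth : ∀ m < n, expMoment μ s (P n * P m) = 0) :
    ∀ f : ℝ[X], f.degree < n → expMoment μ s (P n * f) = 0 := by
  suffices H : ∀ m ≤ n, ∀ f : ℝ[X], f.degree < m → expMoment μ s (P n * f) = 0 from H n le_rfl
  intro m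
  induction m with
  | zero =>
    intro _ f hf
    have : f = 0 := by
      rw [← degree_eq_bot]
      simpa using hf
    simp [this, expMoment_zero]
  | succ m ih =>
    intro hm f hf
    set a := f.coeff m / (P m).leadingCoeff with ha
    have hlc : (P m).coeff m ≠ 0 := by
      have := leadingCoeff_ne_zero.mpr (hne m)
      rwa [leadingCoeff, hdeg] at this
    have hg : (f - C a * P m).degree < m := by
      rw [degree_lt_iff_coeff_zero]
      intro k hk
      rcases hk.eq_or_lt with rfl | hk
      · rw [coeff_sub, coeff_C_mul, ha, leadingCoeff, hdeg]
        field_simp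
        ring
      · rw [coeff_sub, coeff_C_mul, (degree_lt_iff_coeff_zero _ _).mp hf k hk,
          coeff_eq_zero_of_natDegree_lt (by rw [hdeg]; exact hk)]
        ring
    have e : P n * f = P n * (f - C a * P m) + C a * (P n * P m) := by ring
    rw [e, expMoment_add hs, expMoment_C_mul, ih (by omega) _ hg, horth m (by omega)]
    ring

/-- If `(X - r) q` annihilates polynomials of degree less than its own, then multiplication by `q`
turns the functional into a multiple of evaluation at `r`. -/
lemma expMoment_mul_eq_eval_mul (hs : s ∈ interior (integrableExpSet id μ)) {q : ℝ[X]} {r : ℝ}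
    {n : ℕ} (hq : ∀ f : ℝ[X], f.degree < n → expMoment μ s ((X - C r) * q * f) = 0)
    (g : ℝ[X]) (hg : g.natDegree ≤ n) (hn : 0 < n) :
    expMoment μ s (g * q) = g.eval r * expMoment μ s q := by
  have hdiv : g = C (g.eval r) + (X - C r) * (g /ₘ (X - C r)) := by
    conv_lhs => rw [← modByMonic_add_div g (X - C r), modByMonic_X_sub_C_eq_C_eval]
  have hd : (g /ₘ (X - C r)).degree < n := by
    refine lt_of_le_of_lt degree_le_natDegree ?_
    rw [natDegree_divByMonic _ (monic_X_sub_C r), natDegree_X_sub_C]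
    exact_mod_cast (by omega : g.natDegree - 1 < n)
  have e : g * q = C (g.eval r) * q + (X - C r) * q * (g /ₘ (X - C r)) := by
    conv_lhs => rw [hdiv]
    ring
  rw [e, expMoment_add hs, expMoment_C_mul, hq _ hd, add_zero]

end ExpMoment

section OrderedZeros

variable {ι : Type*} [LinearOrder ι] [Fintype ι]

lemma abs_sub_lt_of_prod_lt {a b : ι → ℝ} (hb : StrictMono b) {ε : ℝ} (hε : 0 < ε)
    (hgap : ∀ i j, i < j → 2 * ε ≤ a j - a i)
    (hprod : ∀ i, |∏ j, (a i - b j)| < ε ^ Fintype.card ι) (i : ι) : |a i - b i| < ε := by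
  have hex : ∀ i, ∃ j, |a i - b j| < ε := by
    intro i
    by_contra! h
    refine absurd (hprod i) (not_lt.mpr ?_)
    rw [Finset.abs_prod, ← Finset.card_univ, ← Finset.prod_const]
    exact Finset.prod_le_prod (fun _ _ => hε.le) fun j _ => h j
  choose σ hσ using hex
  have hmono : StrictMono σ := by
    intro i j hij
    rw [← hb.lt_iff_lt]
    have h1 := abs_lt.mp (hσ i)
    have h2 := abs_lt.mp (hσ j)
    have h3 := hgap i j hij
    linarith [h1.1, h2.2]
  have : σ i = i := le_antisymm hmono.apply_le hmono.le_apply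
  simpa [this] using hσ i

lemma continuousAt_of_tendsto_prod {b : ℝ → ι → ℝ} {t₀ : ℝ}
    (hb : ∀ᶠ t in 𝓝 t₀, StrictMono (b t))
    (hprod : ∀ i, Tendsto (fun t => ∏ j, (b t₀ i - b t j)) (𝓝 t₀) (𝓝 0)) (i : ι) :
    ContinuousAt (fun t => b t i) t₀ := by
  rw [Metric.continuousAt_iff']
  intro δ hδ
  have h1 : ∀ᶠ ε : ℝ in 𝓝[>] 0, ∀ i j, i < j → 2 * ε ≤ b t₀ j - b t₀ i := by
    refine nhdsWithin_le_nhds (eventually_all.mpr fun i => eventually_all.mpr fun j => ?_)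
    by_cases hij : i < j
    · have hpos : 0 < b t₀ j - b t₀ i := sub_pos.mpr (hb.self_of_nhds hij)
      filter_upwards [gt_mem_nhds (half_pos hpos)] with ε hε _
      linarith
    · exact Eventually.of_forall fun _ h => absurd h hij
  have h2 : ∀ᶠ ε : ℝ in 𝓝[>] 0, ε < δ := nhdsWithin_le_nhds (gt_mem_nhds hδ)
  obtain ⟨ε, hgap, hεδ, hε⟩ := (h1.and (h2.and self_mem_nhdsWithin)).exists
  have hε : 0 < ε := hε
  have h3 : ∀ᶠ t in 𝓝 t₀, ∀ i, |∏ j, (b t₀ i - b t j)| < ε ^ Fintype.card ι := by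
    refine eventually_all.mpr fun i => ?_
    have := (Metric.tendsto_nhds.mp (hprod i)) _ (pow_pos hε (Fintype.card ι))
    simpa only [Real.dist_eq, sub_zero] using this
  filter_upwards [hb, h3] with t ht ht3
  rw [dist_comm, Real.dist_eq]
  exact (abs_sub_lt_of_prod_lt ht hε hgap ht3 i).trans hεδ

end OrderedZeros

/-- If `f` vanishes at `t₀` and factors as `h * (y t₀ - y)` with `h` continuous and nonzero at `t₀`,
then `y` is differentiable at `t₀`. -/
lemma hasDerivAt_of_eq_mul_sub {f h y : ℝ → ℝ} {t₀ f' : ℝ} (hf : HasDerivAt f f' t₀)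
    (hh : ContinuousAt h t₀) (hne : h t₀ ≠ 0)
    (heq : ∀ᶠ t in 𝓝 t₀, f t = h t * (y t₀ - y t)) :
    HasDerivAt y (-(f' / h t₀)) t₀ := by
  have hf0 : f t₀ = 0 := by simpa using heq.self_of_nhds
  rw [hasDerivAt_iff_tendsto_slope] at hf ⊢
  have hlim := (hf.div (hh.tendsto.mono_left nhdsWithin_le_nhds) hne).neg
  refine hlim.congr' ?_
  filter_upwards [nhdsWithin_le_nhds heq, nhdsWithin_le_nhds (hh.eventually_ne hne)] with t ht htne
  simp only [Pi.div_apply, slope_def_field, hf0, ht]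
  field_simp
  ring

lemma integral_withDensity_wgt (ℓ : ℕ) (ζ : ℝ) (f : ℝ[X]) :
    ∫ x in Set.Ioi (1 : ℝ), f.eval x * wgt ℓ ζ x =
      expMoment ((volume.restrict (Set.Ioi (1 : ℝ))).withDensity
        fun x => ENNReal.ofReal ((x ^ 2 - 1) ^ ((ℓ : ℝ) - 1 / 2))) (-ζ) f / besselK 1 ζ := by
  rw [expMoment, integral_withDensity_eq_integral_toReal_smul (by fun_prop) (by simp),
    ← integral_div]
  refine setIntegral_congr_fun measurableSet_Ioi fun x (hx : 1 < x) => ?_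
  have : 0 ≤ (x ^ 2 - 1) ^ ((ℓ : ℝ) - 1 / 2) := Real.rpow_nonneg (by nlinarith) _
  simp only [ENNReal.toReal_ofReal this, wgt, smul_eq_mul]
  ring

/-- Zeros of a differentiable family of polynomials, orthonormal with respect to
`e^{-ζx} dμ(x)` up to normalization, have negative derivative. -/
lemma exists_hasDerivAt_zero_neg {μ : Measure ℝ} {K : ℝ → ℝ}
    (P : ℝ → ℕ → Polynomial ℝ) (lc : ℝ → ℕ → ℝ)
    (hdeg : ∀ ζ : ℝ, 0 < ζ → ∀ n, (P ζ n).natDegree = n)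
    (hlc : ∀ ζ : ℝ, 0 < ζ → ∀ n, (P ζ n).leadingCoeff = lc ζ n)
    (hlcpos : ∀ ζ : ℝ, 0 < ζ → ∀ n, 0 < lc ζ n)
    (horth : ∀ ζ : ℝ, 0 < ζ → ∀ m n,
      expMoment μ (-ζ) (P ζ m * P ζ n) / K ζ = if m = n then (1 : ℝ) else 0)
    (hcoeff : ∀ n k, DifferentiableOn ℝ (fun ζ => (P ζ n).coeff k) (Set.Ioi 0))
    (z : ℝ → ℕ → ℕ → ℝ)
    (hzfac : ∀ ζ : ℝ, 0 < ζ → ∀ n,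
      P ζ n = C (lc ζ n) * ∏ i ∈ Finset.Icc 1 n, (X - C (z ζ n i)))
    (hzmono : ∀ ζ : ℝ, 0 < ζ → ∀ n i j, 1 ≤ i → i < j → j ≤ n → z ζ n i < z ζ n j)
    {n i : ℕ} (hn : 1 ≤ n) (hi : 1 ≤ i) (hin : i ≤ n) {ζ : ℝ} (hζ : 0 < ζ) :
    ∃ d < 0, HasDerivAt (fun t => z t n i) d ζ := by
  have hpos : ∀ᶠ t in 𝓝 ζ, 0 < t := lt_mem_nhds hζ
  have hne : ∀ t, 0 < t → ∀ m, P t m ≠ 0 := fun t ht m h => by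
    have := hlc t ht m
    rw [h, leadingCoeff_zero] at this
    exact (hlcpos t ht m).ne this
  have hK : ∀ t, 0 < t → K t ≠ 0 := fun t ht h => by
    have := horth t ht 0 0
    simp [h] at this
  have hdiag : ∀ t, 0 < t → ∀ m, expMoment μ (-t) (P t m * P t m) = K t := fun t ht m => by
    have := horth t ht m m
    rwa [if_pos rfl, div_eq_one_iff_eq (hK t ht)] at this
  have hoff : ∀ t, 0 < t → ∀ m k, m ≠ k → expMoment μ (-t) (P t m * P t k) = 0 :=
    fun t ht m k hmk => by
      have := horth t ht m k
      rw [if_neg hmk, div_eq_zero_iff] at this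
      exact this.resolve_right (hK t ht)
  have hKpos : 0 < K ζ :=
    lt_of_le_of_ne (hdiag ζ hζ 0 ▸ expMoment_mul_self_nonneg _) (hK ζ hζ).symm
  have hexp : ∀ t : ℝ, t < 0 → t ∈ integrableExpSet id μ := fun t ht => by
    have h0 : 0 < -t := by linarith
    by_contra hmem_int
    have h1 := hdiag (-t) h0 0
    have hc : P (-t) 0 = C (lc (-t) 0) := by simpa using hzfac (-t) h0 0
    have hl := (hlcpos (-t) h0 0).ne'
    rw [neg_neg, hc, expMoment_C_mul] at h1
    refine hK (-t) h0 (h1.symm.trans ?_)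
    rw [expMoment, integral_undef, mul_zero]
    intro h
    refine hmem_int ?_
    have := h.const_mul (lc (-t) 0)⁻¹
    simpa [integrableExpSet, hl] using this
  have hmem_int : ∀ t : ℝ, 0 < t → -t ∈ interior (integrableExpSet id μ) := fun t ht =>
    mem_interior.mpr ⟨Set.Iio 0, hexp, isOpen_Iio, by simpa using ht⟩
  have hortho : ∀ t, 0 < t → ∀ f : ℝ[X], f.degree < n → expMoment μ (-t) (P t n * f) = 0 :=
    fun t ht => expMoment_mul_eq_zero_of_degree_lt (hmem_int t ht) (hdeg t ht) (hne t ht)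
      fun m hm => hoff t ht n m hm.ne'
  set c' : ℕ → ℝ := fun k => deriv (fun t => (P t n).coeff k) ζ
  have hcd : ∀ k, HasDerivAt (fun t => (P t n).coeff k) (c' k) ζ := fun k =>
    ((hcoeff n k).differentiableAt (Ioi_mem_nhds hζ)).hasDerivAt
  have hsum : ∀ t, 0 < t → P t n = ∑ k ∈ Finset.range (n + 1), C ((P t n).coeff k) * X ^ k :=
    fun t ht => as_sum_range_C_mul_X_pow' (P t n) (by rw [hdeg t ht]; omega)
  set D : ℝ[X] := ∑ k ∈ Finset.range (n + 1), C (c' k) * X ^ k with hD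
  have hDdeg : D.natDegree ≤ n := natDegree_sum_le_of_forall_le _ _ fun k hk =>
    (natDegree_C_mul_X_pow_le _ _).trans (by simpa [Nat.lt_succ_iff] using hk)
  have heval : ∀ r, HasDerivAt (fun t => (P t n).eval r) (D.eval r) ζ := fun r => by
    have h := HasDerivAt.fun_sum (u := Finset.range (n + 1)) fun k _ => (hcd k).mul_const (r ^ k)
    have e : D.eval r = ∑ k ∈ Finset.range (n + 1), c' k * r ^ k := by
      simp [hD, eval_finsetSum]
    rw [e]
    refine h.congr_of_eventuallyEq ?_
    filter_upwards [hpos] with t ht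
    conv_lhs => rw [hsum t ht]
    simp [eval_finsetSum]
  have hlcn : ∀ t, 0 < t → lc t n = (P t n).coeff n := fun t ht => by
    rw [← hlc t ht, leadingCoeff, hdeg t ht]
  have hlcc : ContinuousAt (fun t => lc t n) ζ := by
    refine (hcd n).continuousAt.congr ?_
    filter_upwards [hpos] with t ht using (hlcn t ht).symm
  -- continuity of the zeros
  have hPeval : ∀ t, 0 < t → ∀ r,
      (P t n).eval r = lc t n * ∏ j ∈ Finset.Icc 1 n, (r - z t n j) := fun t ht r => by
    conv_lhs => rw [hzfac t ht n]
    simp [eval_prod]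
  have hroot : ∀ j ∈ Finset.Icc 1 n, (P ζ n).eval (z ζ n j) = 0 := fun j hj => by
    rw [hPeval ζ hζ, Finset.prod_eq_zero hj (sub_self _), mul_zero]
  have hcont : ∀ j ∈ Finset.Icc 1 n, ContinuousAt (fun t => z t n j) ζ := by
    intro j hj
    refine continuousAt_of_tendsto_prod (ι := Finset.Icc 1 n) (b := fun t k => z t n k)
      ?_ ?_ ⟨j, hj⟩
    · filter_upwards [hpos] with t ht k l hkl
      exact hzmono t ht n k l (Finset.mem_Icc.mp k.2).1 hkl (Finset.mem_Icc.mp l.2).2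
    · intro k
      have h := (heval (z ζ n k)).continuousAt.tendsto.div hlcc.tendsto (hlcpos ζ hζ n).ne'
      rw [hroot k k.2, zero_div] at h
      refine h.congr' ?_
      filter_upwards [hpos] with t ht
      rw [Pi.div_apply, hPeval t ht, mul_div_cancel_left₀ _ (hlcpos t ht n).ne']
      exact (Finset.prod_coe_sort (Finset.Icc 1 n) fun l => z ζ n k - z t n l).symm
  -- the cofactor of the zero
  have hmem : i ∈ Finset.Icc 1 n := Finset.mem_Icc.mpr ⟨hi, hin⟩
  set r := z ζ n i with hr
  set q : ℝ[X] := C (lc ζ n) * ∏ j ∈ (Finset.Icc 1 n).erase i, (X - C (z ζ n j)) with hq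
  have hPq : P ζ n = (X - C r) * q := by
    rw [hzfac ζ hζ n, ← Finset.mul_prod_erase _ _ hmem, hq]
    ring
  have hq0 : q ≠ 0 := fun h => hne ζ hζ n (by rw [hPq, h, mul_zero])
  have hqdeg : q.natDegree + 1 = n := by
    have h := hdeg ζ hζ n
    rw [hPq, natDegree_mul (X_sub_C_ne_zero r) hq0, natDegree_X_sub_C] at h
    omega
  have hqdeg' : q.degree < n := lt_of_le_of_lt degree_le_natDegree (by exact_mod_cast (by omega))
  set h : ℝ → ℝ := fun t => lc t n * ∏ j ∈ (Finset.Icc 1 n).erase i, (r - z t n j) with hh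
  have hhq : h ζ = q.eval r := by simp [hh, hq, eval_prod]
  have hhc : ContinuousAt h ζ := hlcc.mul <| tendsto_finsetProd _ fun j hj =>
    (continuousAt_const.sub (hcont j (Finset.mem_of_mem_erase hj))).tendsto
  have hhne : h ζ ≠ 0 := by
    refine mul_ne_zero (hlcpos ζ hζ n).ne' (Finset.prod_ne_zero_iff.mpr fun j hj => ?_)
    obtain ⟨hji, hj⟩ := Finset.mem_erase.mp hj
    obtain ⟨hj1, hjn⟩ := Finset.mem_Icc.mp hj
    rcases lt_or_gt_of_ne hji with hlt | hlt
    · exact (sub_pos.mpr (hzmono ζ hζ n j i hj1 hlt hin)).ne'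
    · exact (sub_neg.mpr (hzmono ζ hζ n i j hi hlt hjn)).ne
  refine ⟨-(D.eval r / h ζ), ?_, hasDerivAt_of_eq_mul_sub (heval r) hhc hhne ?_⟩
  swap
  · filter_upwards [hpos] with t ht
    rw [hPeval t ht, ← Finset.mul_prod_erase _ _ hmem, hh]
    ring
  -- differentiate the orthogonality relation against the cofactor
  have hqorth : ∀ f : ℝ[X], f.degree < n → expMoment μ (-ζ) ((X - C r) * q * f) = 0 :=
    fun f hf => hPq ▸ hortho ζ hζ f hf
  have hderiv : expMoment μ (-ζ) (D * q) = expMoment μ (-ζ) (X * (P ζ n * q)) := by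
    have h1 := hasDerivAt_expMoment_sum_mul (hmem_int ζ hζ) (n + 1)
      (fun s k => (P (-s) n).coeff k) (fun k => -c' k) (fun k => by
        have h0 : HasDerivAt (fun t => (P t n).coeff k) (c' k) (-(-ζ)) := by
          rw [neg_neg]; exact hcd k
        have h1 := h0.comp (-ζ) (hasDerivAt_neg (-ζ))
        rw [mul_neg_one] at h1
        exact h1) q
    have h2 : (fun s => expMoment μ s
        ((∑ k ∈ Finset.range (n + 1), C ((P (-s) n).coeff k) * X ^ k) * q))
        =ᶠ[𝓝 (-ζ)] fun _ => 0 := by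
      filter_upwards [gt_mem_nhds (neg_lt_zero.mpr hζ)] with s hs
      rw [← hsum (-s) (neg_pos.mpr hs)]
      simpa using hortho (-s) (neg_pos.mpr hs) q hqdeg'
    have h3 := h1.unique ((hasDerivAt_const (-ζ) (0 : ℝ)).congr_of_eventuallyEq h2)
    have h4 : (∑ k ∈ Finset.range (n + 1), C (-c' k) * X ^ k) * q = C (-1) * (D * q) := by
      simp [hD, Finset.sum_neg_distrib]
    rw [h4, expMoment_C_mul, neg_neg, ← hsum ζ hζ] at h3
    linarith
  have hXP : expMoment μ (-ζ) (X * (P ζ n * q)) = K ζ := by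
    have e : X * (P ζ n * q) = P ζ n * P ζ n + C r * (P ζ n * q) := by
      rw [hPq]
      ring
    rw [e, expMoment_add (hmem_int ζ hζ), expMoment_C_mul, hdiag ζ hζ, hortho ζ hζ q hqdeg']
    ring
  have hDq : 0 < D.eval r * expMoment μ (-ζ) q := by
    rw [← expMoment_mul_eq_eval_mul (hmem_int ζ hζ) hqorth D hDdeg hn, hderiv, hXP]
    exact hKpos
  have hqq : 0 ≤ h ζ * expMoment μ (-ζ) q := by
    rw [hhq, ← expMoment_mul_eq_eval_mul (hmem_int ζ hζ) hqorth q (by omega) hn]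
    exact expMoment_mul_self_nonneg q
  have hLq : expMoment μ (-ζ) q ≠ 0 := right_ne_zero_of_mul hDq.ne'
  rw [neg_lt_zero, ← mul_div_mul_right _ _ hLq]
  exact div_pos hDq (lt_of_le_of_ne hqq (mul_ne_zero hhne hLq).symm)

theorem stmt14
    (ℓ : ℕ) (hℓ : ℓ ≤ 1)
    (P : ℝ → ℕ → Polynomial ℝ) (lc : ℝ → ℕ → ℝ)
    (hdeg : ∀ ζ : ℝ, 0 < ζ → ∀ n, (P ζ n).natDegree = n)
    (hlc : ∀ ζ : ℝ, 0 < ζ → ∀ n, (P ζ n).leadingCoeff = lc ζ n)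
    (hlcpos : ∀ ζ : ℝ, 0 < ζ → ∀ n, 0 < lc ζ n)
    (horth : ∀ ζ : ℝ, 0 < ζ → ∀ m n, (∫ x in Set.Ioi (1 : ℝ),
        (P ζ m).eval x * (P ζ n).eval x * wgt ℓ ζ x) = if m = n then (1 : ℝ) else 0)
    (hcoeff : ∀ n k, DifferentiableOn ℝ (fun ζ => (P ζ n).coeff k) (Set.Ioi 0))
    (z : ℝ → ℕ → ℕ → ℝ)
    (hzfac : ∀ ζ : ℝ, 0 < ζ → ∀ n,
      P ζ n = C (lc ζ n) * ∏ i ∈ Finset.Icc 1 n, (X - C (z ζ n i)))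
    (hzgt : ∀ ζ : ℝ, 0 < ζ → ∀ n i, 1 ≤ i → i ≤ n → 1 < z ζ n i)
    (hzmono : ∀ ζ : ℝ, 0 < ζ → ∀ n i j, 1 ≤ i → i < j → j ≤ n → z ζ n i < z ζ n j) :
    ∀ n i : ℕ, 1 ≤ n → 1 ≤ i → i ≤ n →
      (DifferentiableOn ℝ (fun ζ => z ζ n i) (Set.Ioi 0)) ∧
      (∀ ζ : ℝ, 0 < ζ → deriv (fun t => z t n i) ζ < 0) ∧
      StrictAntiOn (fun ζ => z ζ n i) (Set.Ioi 0) := by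
  intro n i hn hi hin
  have key : ∀ ζ : ℝ, 0 < ζ → ∃ d < 0, HasDerivAt (fun t => z t n i) d ζ := fun ζ hζ =>
    exists_hasDerivAt_zero_neg (K := besselK 1) P lc hdeg hlc hlcpos
      (fun t ht m k => by
        rw [← integral_withDensity_wgt ℓ, ← horth t ht m k]
        simp only [eval_mul])
      hcoeff z hzfac hzmono hn hi hin hζ
  have hdiff : DifferentiableOn ℝ (fun ζ => z ζ n i) (Set.Ioi 0) := fun ζ hζ => by
    obtain ⟨d, -, hd⟩ := key ζ hζ
    exact hd.differentiableAt.differentiableWithinAt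
  have hneg : ∀ ζ : ℝ, 0 < ζ → deriv (fun t => z t n i) ζ < 0 := fun ζ hζ => by
    obtain ⟨d, hd0, hd⟩ := key ζ hζ
    rwa [hd.deriv]
  exact ⟨hdiff, hneg, strictAntiOn_of_deriv_neg (convex_Ioi 0) hdiff.continuousOn
    fun ζ hζ => hneg ζ (by simpa using hζ)⟩
end
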